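/- arXiv:2302.01655 — 2 statements merged into one kernel-verified Lean document; each statement's English description precedes it below -/
import Mathlib

section
/- Let q0 be a prime power and F a finite field with q0² elements, with involution x ↦ x̄ = x^{q0}. Then every †-symmetric monic irreducible polynomial over F has odd degree and constant coefficient in U. Moreover, for every n ≥ 1 and every a ∈ U, the number π† of †-symmetric monic irreducible polynomials of degree 2n−1 over F with constant coefficient −a satisfies π† = (1/(2n−1))·∑_{d ∣ 2n−1} μ(d)·r_d(a)·(q0^{(2n−1)/d} + 1)/(q0 + 1), where r_d(a) is the number of d-th roots of a in U; moreover π† = (q0^{2n−1} + 1 − ε·q0^{(2n−1)/3})/((2n−1)·(q0+1)) for some real ε with 0 ≤ ε ≤ 40. -/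
open Polynomial

/-- `f` is †-symmetric with respect to the involution `σ`: `f(0) ≠ 0` and `f† = f`, where
`f†(X) = Xⁿ f̄(1/X)/f̄(0)` and `f̄` applies `σ` to the coefficients of `f`;
expressed via `(f.map σ).reverse = σ(f(0)) • f`. -/
def IsDaggerSymm {F : Type} [Field F] (σ : F →+* F) (f : F[X]) : Prop :=
  f.coeff 0 ≠ 0 ∧ (f.map σ).reverse = Polynomial.C (σ (f.coeff 0)) * f

/-- The quotient `(x ^ d + 1) / (x + 1)`, for odd `d`, is congruent to `d` modulo `c + 1` whenever
`c + 1` divides `x + 1`. -/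
lemma exists_mul_succ_eq_pow_succ {c x d : ℕ} (hd : Odd d) (hx : 1 ≤ x) (hc : c + 1 ∣ x + 1) :
    ∃ t, t * (x + 1) = x ^ d + 1 ∧ t ≡ d [MOD c + 1] := by
  obtain ⟨j, rfl⟩ := hd
  obtain ⟨y, rfl⟩ := Nat.exists_eq_add_of_le' hx
  have hy : ((y : ℤ) + 2) ≡ 0 [ZMOD c + 1] := by
    refine (Int.modEq_zero_iff_dvd).2 ?_
    have := Int.natCast_dvd_natCast.2 hc
    push_cast at this
    convert this using 1
    ring
  have hy' : (y : ℤ) ≡ -2 [ZMOD c + 1] := by simpa using hy.sub_right 2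
  induction j with
  | zero => exact ⟨1, by simp, rfl⟩
  | succ j ih =>
    obtain ⟨t, ht, htd⟩ := ih
    refine ⟨t + (y + 1) ^ (2 * j + 1) * y, ?_, ?_⟩
    · rw [add_mul, ht]
      ring
    · have h : ((y : ℤ) + 1) ^ (2 * j + 1) * y ≡ 2 [ZMOD c + 1] := by
        have := ((hy'.add_right 1).pow (2 * j + 1)).mul hy'
        simpa [Odd.neg_one_pow (⟨j, rfl⟩ : Odd (2 * j + 1))] using this
      have htd' := (Int.natCast_modEq_iff).2 htd
      refine (Int.natCast_modEq_iff).1 ?_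
      push_cast at htd' ⊢
      have := htd'.add h
      convert this using 1
      ring

/-- The index `(q ^ m + 1) / (q + 1)` of the group of order `q + 1` in that of order `q ^ m + 1`. -/
def unitaryIndex (q m : ℕ) : ℕ := (q ^ m + 1) / (q + 1)

lemma unitaryIndex_mul {q m : ℕ} (hq : 1 ≤ q) (hm : Odd m) :
    unitaryIndex q m * (q + 1) = q ^ m + 1 := by
  obtain ⟨t, ht, -⟩ := exists_mul_succ_eq_pow_succ hm hq dvd_rfl
  exact Nat.div_mul_cancel ⟨t, by rw [← ht, mul_comm]⟩

lemma unitaryIndex_pos {q m : ℕ} (hq : 1 ≤ q) (hm : Odd m) : 0 < unitaryIndex q m := by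
  refine Nat.pos_of_ne_zero fun h ↦ ?_
  have := unitaryIndex_mul hq hm
  simp [h] at this

lemma exists_unitaryIndex_mul_eq {q d e : ℕ} (hq : 1 ≤ q) (hd : Odd d) (he : Odd e) :
    ∃ t, unitaryIndex q (d * e) = unitaryIndex q e * t ∧ t ≡ d [MOD q + 1] := by
  have hdvd : q + 1 ∣ q ^ e + 1 := ⟨_, by rw [← unitaryIndex_mul hq he, mul_comm]⟩
  obtain ⟨t, ht, htd⟩ := exists_mul_succ_eq_pow_succ hd (Nat.one_le_pow e q hq) hdvd
  refine ⟨t, ?_, htd⟩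
  refine Nat.eq_of_mul_eq_mul_right (Nat.succ_pos q) ?_
  rw [unitaryIndex_mul hq (hd.mul he), mul_right_comm, unitaryIndex_mul hq he, mul_comm _ t, ht,
    ← pow_mul, mul_comm e]

lemma sum_sq_pow_eq {q m : ℕ} (hq : 2 ≤ q) (hm : Odd m) :
    ∃ s, ∑ i ∈ Finset.range m, (q ^ 2) ^ i = unitaryIndex q m * s ∧ s ≡ 1 [MOD q + 1] := by
  refine ⟨∑ i ∈ Finset.range m, q ^ i, ?_, ?_⟩
  · have h0 : ((q : ℤ) ^ 2 - 1) ≠ 0 := by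
      have : (2 : ℤ) ≤ q := by exact_mod_cast hq
      nlinarith
    have h1 := geom_sum_mul ((q : ℤ) ^ 2) m
    have h2 := geom_sum_mul (q : ℤ) m
    have h3 : (unitaryIndex q m : ℤ) * (q + 1) = q ^ m + 1 := by
      exact_mod_cast unitaryIndex_mul (one_le_two.trans hq) hm
    have h4 : ((q : ℤ) ^ 2) ^ m = (q ^ m) ^ 2 := by ring
    refine Int.ofNat_inj.1 (mul_right_cancel₀ h0 ?_)
    push_cast
    rw [h1, h4]
    linear_combination (-(q : ℤ) ^ m - 1) * h2 - (∑ i ∈ Finset.range m, (q : ℤ) ^ i) * (q - 1) * h3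
  · rw [← ZMod.natCast_eq_natCast_iff]
    have h : (q : ZMod (q + 1)) = -1 := by
      rw [eq_neg_iff_add_eq_zero]
      exact_mod_cast ZMod.natCast_self (q + 1)
    push_cast
    rw [h, neg_one_geom_sum, if_neg (Nat.not_even_iff_odd.2 hm)]

section FiniteField

variable {F K : Type} [Field F] [Fintype F] [Field K] [Algebra F K]

lemma pow_card_pow_eq_self_iff [Algebra.IsAlgebraic F K] (α : K) (j : ℕ) :
    α ^ Fintype.card F ^ j = α ↔ (minpoly F α).natDegree ∣ j := by
  have hα : IsIntegral F α := Algebra.IsIntegral.isIntegral α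
  rw [(minpoly.irreducible hα).natDegree_dvd_iff_dvd_X_pow_card_pow_sub_X, minpoly.dvd_iff,
    Nat.card_eq_fintype_card]
  simp [sub_eq_zero]

lemma exists_eq_pow_of_aeval_minpoly_eq_zero [Algebra.IsAlgebraic F K] {α β : K}
    (hβ : aeval β (minpoly F α) = 0) (hmem : β ∈ IntermediateField.adjoin F {α}) :
    ∃ i, β = α ^ Fintype.card F ^ i := by
  have hα : IsIntegral F α := Algebra.IsIntegral.isIntegral α
  let L := IntermediateField.adjoin F {α}
  have : FiniteDimensional F L := IntermediateField.adjoin.finiteDimensional hα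
  have : Finite L := Module.finite_of_finite F
  let x : L := IntermediateField.AdjoinSimple.gen F α
  let y : L := ⟨β, hmem⟩
  have hconj : IsConjRoot F y x := by
    refine (isConjRoot_of_aeval_eq_zero (Algebra.IsIntegral.isIntegral x) ?_).symm
    have hx : minpoly F x = minpoly F α := minpoly.algebraMap_eq (algebraMap L K).injective x |>.symm
    rw [hx]
    apply (algebraMap L K).injective
    rw [map_zero, ← aeval_algebraMap_apply]
    exact hβ
  obtain ⟨g, hg⟩ := isConjRoot_iff_exists_algEquiv.1 hconj
  obtain ⟨i, hi⟩ := (FiniteField.bijective_frobeniusAlgEquivOfAlgebraic_pow F L).2 g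
  refine ⟨i, ?_⟩
  have h : y = x ^ Fintype.card F ^ (i : ℕ) := by
    rw [← hg, ← hi]
    simp [FiniteField.coe_frobeniusAlgEquivOfAlgebraic_iterate]
  exact congrArg Subtype.val h

lemma algebraMap_minpoly_coeff_zero [Algebra.IsAlgebraic F K] (α : K) :
    (-1) ^ (minpoly F α).natDegree * algebraMap F K ((minpoly F α).coeff 0) =
      α ^ ∑ i ∈ Finset.range (minpoly F α).natDegree, Fintype.card F ^ i := by
  have hα : IsIntegral F α := Algebra.IsIntegral.isIntegral α
  let L := IntermediateField.adjoin F {α}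
  have : FiniteDimensional F L := IntermediateField.adjoin.finiteDimensional hα
  have : Finite L := Module.finite_of_finite F
  let pb := IntermediateField.adjoin.powerBasis hα
  have hgen : pb.gen = IntermediateField.AdjoinSimple.gen F α := rfl
  have hx : minpoly F pb.gen = minpoly F α :=
    (minpoly.algebraMap_eq (algebraMap L K).injective pb.gen).symm
  have h1 := FiniteField.algebraMap_norm_eq_pow_sum F L pb.gen
  rw [Algebra.PowerBasis.norm_gen_eq_coeff_zero_minpoly, hx, IntermediateField.adjoin.finrank hα,
    Nat.card_eq_fintype_card] at h1
  have h2 := congrArg (algebraMap L K) h1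
  rw [← IsScalarTower.algebraMap_apply, map_mul, map_pow, map_pow] at h2
  have hdim : pb.dim = (minpoly F α).natDegree := rfl
  have hval : algebraMap L K pb.gen = α := rfl
  rwa [hdim, hval, map_neg, map_one] at h2

lemma mem_range_algebraMap_of_pow_card [Algebra.IsAlgebraic F K] {α : K}
    (h : α ^ Fintype.card F = α) : ∃ b : F, algebraMap F K b = α := by
  have h1 := (pow_card_pow_eq_self_iff (F := F) α 1).1 (by simpa using h)
  exact minpoly.natDegree_eq_one_iff.1 (Nat.dvd_one.1 h1)

lemma card_toFinset_nthRoots [DecidableEq K] [IsAlgClosed K] {n : ℕ} {a : K} (hn : (n : K) ≠ 0)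
    (ha : a ≠ 0) : (nthRoots n a).toFinset.card = n := by
  rw [Multiset.toFinset_card_of_nodup, nthRoots, ← (IsAlgClosed.splits _).natDegree_eq_card_roots,
    natDegree_X_pow_sub_C]
  exact nodup_roots (separable_X_pow_sub_C a hn ha)

end FiniteField

section Dagger

variable {F K : Type} [Field F] [Fintype F] [Field K] [Algebra F K] [Algebra.IsAlgebraic F K]
  {q : ℕ}

lemma pow_inv_eq_of_pow_succ_eq_one {β : K} {n : ℕ} (h : β ^ (n + 1) = 1) : β ^ n = β⁻¹ :=
  eq_inv_of_mul_eq_one_left (by rw [← pow_succ, h])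

omit [Fintype F] in
lemma isDaggerSymm_minpoly_iff_aeval (φ : K →+* K) (hφ : ∀ x, φ x = x ^ q)
    (σ : F →+* F) (hσ : ∀ x, σ x = x ^ q) (α : K) :
    IsDaggerSymm σ (minpoly F α) ↔ α ≠ 0 ∧ aeval (α ^ q)⁻¹ (minpoly F α) = 0 := by
  have hα : IsIntegral F α := Algebra.IsIntegral.isIntegral α
  have h0 : (minpoly F α).coeff 0 ≠ 0 ↔ α ≠ 0 :=
    (minpoly.coeff_zero_eq_zero hα).not
  rw [IsDaggerSymm, h0, and_congr_right_iff]
  intro hα0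
  have hc : σ ((minpoly F α).coeff 0) ≠ 0 := (_root_.map_ne_zero σ).2 (h0.2 hα0)
  have hcomp : (algebraMap F K).comp σ = φ.comp (algebraMap F K) := by
    ext x
    simp [hσ, hφ]
  have hroot : aeval (α ^ q)⁻¹ ((minpoly F α).map σ).reverse = 0 := by
    let : Invertible (α ^ q) := invertibleOfNonzero (pow_ne_zero q hα0)
    rw [← invOf_eq_inv, aeval_def, eval₂_reverse_eq_zero_iff, eval₂_map, hcomp, ← hφ,
      ← hom_eval₂, ← aeval_def, minpoly.aeval, map_zero]
  constructor
  · intro h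
    rw [h, map_mul, aeval_C] at hroot
    exact (mul_eq_zero.1 hroot).resolve_left (by simpa using hc)
  · intro h
    have hmin : minpoly F α = minpoly F (α ^ q)⁻¹ :=
      minpoly.eq_of_irreducible_of_monic (minpoly.irreducible hα) h (minpoly.monic hα)
    have hdvd : minpoly F α ∣ ((minpoly F α).map σ).reverse := by
      conv_lhs => rw [hmin]
      exact minpoly.dvd _ _ hroot
    have htr : ((minpoly F α).map σ).natTrailingDegree = 0 :=
      natTrailingDegree_eq_zero.2 (Or.inr (by simpa using hc))
    have hlead : ((minpoly F α).map σ).reverse.leadingCoeff = σ ((minpoly F α).coeff 0) := by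
      rw [reverse_leadingCoeff, trailingCoeff, htr, coeff_map]
    rw [← hlead]
    refine eq_leadingCoeff_mul_of_monic_of_dvd_of_natDegree_le (minpoly.monic hα) hdvd ?_
    refine (reverse_natDegree_le _).trans ?_
    rw [natDegree_map]

lemma pow_pow_add_two_mul_eq {α : K} (hcard : Fintype.card F = q ^ 2) (e j : ℕ)
    (h : α ^ Fintype.card F ^ e = α) (r : ℕ) : α ^ q ^ (r + 2 * (e * j)) = α ^ q ^ r := by
  have h1 : α ^ Fintype.card F ^ (e * j) = α := by
    rw [pow_card_pow_eq_self_iff] at h ⊢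
    exact h.mul_right j
  rw [add_comm r, pow_add, pow_mul q, ← hcard, pow_mul, h1]

lemma isDaggerSymm_minpoly_iff (hcard : Fintype.card F = q ^ 2)
    (φ : K →+* K) (hφ : ∀ x, φ x = x ^ q) (σ : F →+* F) (hσ : ∀ x, σ x = x ^ q) (α : K) :
    IsDaggerSymm σ (minpoly F α) ↔
      Odd (minpoly F α).natDegree ∧ α ^ (q ^ (minpoly F α).natDegree + 1) = 1 := by
  have hα : IsIntegral F α := Algebra.IsIntegral.isIntegral α
  set m := (minpoly F α).natDegree with hm
  have hmpos : 0 < m := minpoly.natDegree_pos hα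
  have hfix : α ^ Fintype.card F ^ m = α := (pow_card_pow_eq_self_iff α m).2 dvd_rfl
  rw [isDaggerSymm_minpoly_iff_aeval φ hφ σ hσ]
  constructor
  · rintro ⟨hα0, h⟩
    have hmem : (α ^ q)⁻¹ ∈ IntermediateField.adjoin F {α} :=
      inv_mem (pow_mem (IntermediateField.mem_adjoin_simple_self F α) q)
    obtain ⟨i, hi⟩ := exists_eq_pow_of_aeval_minpoly_eq_zero h hmem
    obtain ⟨r, hr⟩ : ∃ r, 2 * (i + m) = (2 * r + 1) + 1 := ⟨i + m - 1, by omega⟩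
    have hinv : α ^ q ^ (2 * r + 1) = α⁻¹ := by
      have hinj := φ.injective
      apply hinj
      rw [hφ, hφ, ← pow_mul, ← pow_succ, ← hr, inv_pow, hi, hcard, ← pow_mul, mul_add]
      simpa using pow_pow_add_two_mul_eq hcard m 1 hfix (2 * i)
    have hdvd : m ∣ 2 * r + 1 := by
      rw [hm, ← pow_card_pow_eq_self_iff, hcard, ← pow_mul, two_mul, pow_add, pow_mul, hinv,
        inv_pow, hinv, inv_inv]
    obtain ⟨s, hs⟩ := hdvd
    have hodd : Odd (m * s) := hs ▸ ⟨r, rfl⟩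
    obtain ⟨t, rfl⟩ := (Nat.odd_mul.1 hodd).2
    refine ⟨(Nat.odd_mul.1 hodd).1, ?_⟩
    have hexp : 2 * r + 1 = m + 2 * (m * t) := by rw [hs]; ring
    rw [hexp, pow_pow_add_two_mul_eq hcard m t hfix] at hinv
    rw [pow_succ, hinv, inv_mul_cancel₀ hα0]
  · rintro ⟨⟨r, hr⟩, h⟩
    have hα0 : α ≠ 0 := by
      rintro rfl
      simp at h
    refine ⟨hα0, ?_⟩
    have hpow : (α ^ q)⁻¹ = α ^ Fintype.card F ^ (r + 1) := by
      rw [hcard, ← pow_mul, mul_add, mul_one, show 2 * r + 2 = m + 1 by omega, pow_succ, pow_mul,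
        pow_inv_eq_of_pow_succ_eq_one h, inv_pow]
    rw [hpow]
    have : α ^ Fintype.card F ^ (r + 1) =
        ((FiniteField.frobeniusAlgHom F K) ^ (r + 1)) α := by
      rw [AlgHom.coe_pow]
      exact (congrFun (pow_iterate (Fintype.card F) (r + 1)) α).symm
    rw [this, aeval_algHom_apply, minpoly.aeval, map_zero]

lemma pow_unitaryIndex_pow_succ {m : ℕ} (hq : 2 ≤ q) (hm : Odd m) (α : K) :
    (α ^ unitaryIndex q m) ^ (q + 1) = α ^ (q ^ m + 1) := by
  rw [← pow_mul, unitaryIndex_mul (by omega) hm]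

lemma algebraMap_minpoly_coeff_zero_of_unitary (hcard : Fintype.card F = q ^ 2) (hq : 2 ≤ q)
    {α : K} (hm : Odd (minpoly F α).natDegree)
    (h : α ^ (q ^ (minpoly F α).natDegree + 1) = 1) :
    algebraMap F K ((minpoly F α).coeff 0) = -α ^ unitaryIndex q (minpoly F α).natDegree := by
  have h1 := algebraMap_minpoly_coeff_zero (F := F) α
  obtain ⟨s, hs, hs1⟩ := sum_sq_pow_eq hq hm
  rw [hm.neg_one_pow, hcard, hs, pow_mul] at h1
  rw [← pow_unitaryIndex_pow_succ hq hm] at h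
  have h2 : (α ^ unitaryIndex q (minpoly F α).natDegree) ^ s =
      (α ^ unitaryIndex q (minpoly F α).natDegree) ^ 1 :=
    pow_eq_pow_of_modEq hs1 h
  rw [h2, pow_one] at h1
  rw [← h1]
  ring

lemma pow_unitaryIndex_mul_eq_iff (hcard : Fintype.card F = q ^ 2) (hq : 2 ≤ q) {d e : ℕ}
    (hd : Odd d) (he : Odd e) {a : F} (ha : a ^ (q + 1) = 1) (α : K) :
    α ^ unitaryIndex q (d * e) = algebraMap F K a ∧ α ^ Fintype.card F ^ e = α ↔
      ∃ b : F, (b ^ (q + 1) = 1 ∧ b ^ d = a) ∧ α ^ unitaryIndex q e = algebraMap F K b := by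
  have hinj := (algebraMap F K).injective
  obtain ⟨t, ht, htd⟩ := exists_unitaryIndex_mul_eq (q := q) (by omega) hd he
  constructor
  · rintro ⟨h1, h2⟩
    have h3 : α ^ (q ^ (d * e) + 1) = 1 := by
      rw [← pow_unitaryIndex_pow_succ hq (hd.mul he), h1, ← map_pow, ha, map_one]
    obtain ⟨j, rfl⟩ := hd
    have h4 : α ^ q ^ ((2 * j + 1) * e) = α ^ q ^ e := by
      rw [show (2 * j + 1) * e = e + 2 * (e * j) by ring]
      exact pow_pow_add_two_mul_eq hcard e j h2 e
    rw [pow_succ, h4, ← pow_succ, ← pow_unitaryIndex_pow_succ hq he] at h3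
    obtain ⟨b, hb⟩ : ∃ b : F, algebraMap F K b = α ^ unitaryIndex q e := by
      apply mem_range_algebraMap_of_pow_card
      have := pow_inv_eq_of_pow_succ_eq_one h3
      rw [hcard, sq, pow_mul, this, inv_pow, this, inv_inv]
    refine ⟨b, ⟨hinj ?_, hinj ?_⟩, hb.symm⟩
    · rw [map_pow, hb, h3, map_one]
    · rw [map_pow, hb, ← h1, ht, pow_mul]
      exact pow_eq_pow_of_modEq htd.symm h3
  · rintro ⟨b, ⟨hb, rfl⟩, h⟩
    have h3 : (α ^ unitaryIndex q e) ^ (q + 1) = 1 := by rw [h, ← map_pow, hb, map_one]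
    constructor
    · rw [ht, pow_mul, map_pow, ← h]
      exact pow_eq_pow_of_modEq htd h3
    · rw [pow_unitaryIndex_pow_succ hq he] at h3
      have := pow_inv_eq_of_pow_succ_eq_one h3
      rw [hcard, ← pow_mul, two_mul, pow_add, pow_mul, this, inv_pow, this, inv_inv]

end Dagger

section Counting

lemma sum_moebius_divisors (n : ℕ) :
    ∑ d ∈ n.divisors, ArithmeticFunction.moebius d = if n = 1 then 1 else 0 := by
  rw [← ArithmeticFunction.coe_mul_zeta_apply, ArithmeticFunction.moebius_mul_coe_zeta,
    ArithmeticFunction.one_apply]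

lemma divisors_filter_dvd_div {m k : ℕ} (hm : m ≠ 0) (hk : k ∣ m) :
    m.divisors.filter (fun d ↦ k ∣ m / d) = (m / k).divisors := by
  obtain ⟨l, rfl⟩ := hk
  have hk0 : 0 < k := Nat.pos_of_ne_zero (by rintro rfl; simp at hm)
  have hl0 : l ≠ 0 := by rintro rfl; simp at hm
  ext d
  rw [Nat.mul_div_cancel_left l hk0]
  simp only [Finset.mem_filter, Nat.mem_divisors, hm, hl0, ne_eq, not_false_eq_true, and_true]
  constructor
  · rintro ⟨hd, h⟩
    rw [Nat.dvd_div_iff_mul_dvd hd, mul_comm] at h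
    exact Nat.dvd_of_mul_dvd_mul_left hk0 h
  · intro h
    have hd : d ∣ k * l := h.mul_left k
    exact ⟨hd, by rw [Nat.dvd_div_iff_mul_dvd hd, mul_comm]; exact mul_dvd_mul_left k h⟩

/-- Möbius inversion for a statistic `δ` with values in the divisors of `m`. -/
lemma card_filter_eq_sum_moebius {ι : Type*} (S : Finset ι) (δ : ι → ℕ) {m : ℕ}
    (hm : m ≠ 0) (hδ : ∀ x ∈ S, δ x ∣ m) :
    ((S.filter (fun x ↦ δ x = m)).card : ℤ) = ∑ d ∈ m.divisors,
      ArithmeticFunction.moebius d * ((S.filter (fun x ↦ δ x ∣ m / d)).card : ℤ) := by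
  have h : ∀ x ∈ S, (if δ x = m then (1 : ℤ) else 0) =
      ∑ d ∈ m.divisors, if δ x ∣ m / d then ArithmeticFunction.moebius d else 0 := by
    intro x hx
    rw [← Finset.sum_filter, divisors_filter_dvd_div hm (hδ x hx), sum_moebius_divisors]
    have hiff : δ x = m ↔ m / δ x = 1 := by
      obtain ⟨l, hl⟩ := hδ x hx
      have h0 : 0 < δ x := Nat.pos_of_ne_zero (by intro h0; simp [h0] at hl; exact hm hl)
      conv_rhs => rw [hl, Nat.mul_div_cancel_left l h0]
      constructor
      · intro h
        rw [h] at hl h0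
        exact (Nat.mul_eq_left h0.ne').1 hl.symm
      · rintro rfl
        rw [hl, mul_one]
    simp only [hiff]
  rw [Finset.card_filter, Nat.cast_sum]
  push_cast
  rw [Finset.sum_congr rfl h, Finset.sum_comm]
  refine Finset.sum_congr rfl fun d _ ↦ ?_
  rw [← Finset.sum_filter, Finset.sum_const, nsmul_eq_mul, mul_comm]

/-- A union bound for the elements on which the statistic `δ` is a proper divisor of `m`. -/
lemma card_le_card_filter_add_sum_primeFactors {ι : Type*} (S : Finset ι) (δ : ι → ℕ) {m : ℕ}
    (hm : m ≠ 0) (hδ : ∀ x ∈ S, δ x ∣ m) :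
    S.card ≤ (S.filter (fun x ↦ δ x = m)).card +
      ∑ p ∈ m.primeFactors, (S.filter (fun x ↦ δ x ∣ m / p)).card := by
  classical
  have hsub : S.filter (fun x ↦ ¬ δ x = m) ⊆
      m.primeFactors.biUnion (fun p ↦ S.filter (fun x ↦ δ x ∣ m / p)) := by
    intro x hx
    obtain ⟨hxS, hx⟩ := Finset.mem_filter.1 hx
    obtain ⟨l, hl⟩ := hδ x hxS
    have hl1 : l ≠ 1 := by
      rintro rfl
      exact hx (by rw [hl, mul_one])
    obtain ⟨p, hp, c, rfl⟩ := Nat.exists_prime_and_dvd hl1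
    refine Finset.mem_biUnion.2 ⟨p, Nat.mem_primeFactors.2 ⟨hp, ⟨δ x * c, by rw [hl]; ring⟩, hm⟩, ?_⟩
    refine Finset.mem_filter.2 ⟨hxS, c, Nat.div_eq_of_eq_mul_left hp.pos ?_⟩
    rw [hl]
    ring
  rw [← Finset.card_filter_add_card_filter_not (s := S) (fun x ↦ δ x = m)]
  exact Nat.add_le_add_left ((Finset.card_le_card hsub).trans Finset.card_biUnion_le) _

lemma sum_le_prod_of_two_le (s : Finset ℕ) (h : ∀ x ∈ s, 2 ≤ x) : ∑ x ∈ s, x ≤ ∏ x ∈ s, x := by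
  induction s using Finset.induction_on with
  | empty => simp
  | insert a s ha ih =>
    rw [Finset.sum_insert ha, Finset.prod_insert ha]
    have ha2 := h a (Finset.mem_insert_self a s)
    have hs : ∀ x ∈ s, 2 ≤ x := fun x hx ↦ h x (Finset.mem_insert_of_mem hx)
    have ih := ih hs
    obtain rfl | ⟨b, hb⟩ := s.eq_empty_or_nonempty
    · simp
    · have h2 : 2 ≤ ∏ x ∈ s, x := ((hs b hb).trans
        (Finset.single_le_sum (f := fun x ↦ x) (fun _ _ ↦ Nat.zero_le _) hb)).trans ih
      nlinarith

lemma sum_primeFactors_le {m : ℕ} (hm : m ≠ 0) : ∑ p ∈ m.primeFactors, p ≤ m :=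
  (sum_le_prod_of_two_le _ fun _ hp ↦ (Nat.prime_of_mem_primeFactors hp).two_le).trans
    (Nat.le_of_dvd (Nat.pos_of_ne_zero hm) (Nat.prod_primeFactors_dvd m))

lemma natCast_le_rpow_two_mul_div {q : ℕ} (hq : 2 ≤ q) (m : ℕ) :
    (m : ℝ) ≤ 17 * (q : ℝ) ^ (2 * (m : ℝ) / 15) := by
  have h1 : (2 : ℝ) ^ (2 * (m : ℝ) / 15) ≤ (q : ℝ) ^ (2 * (m : ℝ) / 15) :=
    Real.rpow_le_rpow (by norm_num) (by exact_mod_cast hq) (by positivity)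
  have h2 : Real.log 2 * (2 * (m : ℝ) / 15) + 1 ≤ (2 : ℝ) ^ (2 * (m : ℝ) / 15) := by
    rw [Real.rpow_def_of_pos (by norm_num)]
    exact Real.add_one_le_exp _
  have h3 := Real.log_two_gt_d9
  have h4 : (0 : ℝ) ≤ m := m.cast_nonneg
  nlinarith

lemma sum_primeFactors_mul_le {q m : ℕ} (hq : 2 ≤ q) (hm : Odd m) :
    ∑ p ∈ m.primeFactors, (p : ℝ) * ((q : ℝ) ^ (m / p) + 1) ≤ 40 * (q : ℝ) ^ ((m : ℝ) / 3) := by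
  have hq1 : (1 : ℝ) ≤ q := by exact_mod_cast one_le_two.trans hq
  have hm0 : m ≠ 0 := hm.pos.ne'
  set y := (q : ℝ) ^ ((m : ℝ) / 3) with hy
  set z := (q : ℝ) ^ ((m : ℝ) / 5) with hz
  have hy0 : 0 < y := by positivity
  have hz0 : 0 < z := by positivity
  have hyz : y = z * (q : ℝ) ^ (2 * (m : ℝ) / 15) := by
    rw [hy, hz, ← Real.rpow_add (by positivity)]
    congr 1
    ring
  have hmz : m * z ≤ 17 * y := by
    rw [hyz]
    nlinarith [natCast_le_rpow_two_mul_div hq m]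
  have hpow : ∀ p : ℕ, ∀ c : ℝ, 0 < c → c ≤ p → (q : ℝ) ^ (m / p) + 1 ≤
      2 * (q : ℝ) ^ ((m : ℝ) / c) := by
    intro p c hc hcp
    have h1 : (1 : ℝ) ≤ (q : ℝ) ^ ((m : ℝ) / c) := Real.one_le_rpow hq1 (by positivity)
    have h2 : (q : ℝ) ^ (m / p) ≤ (q : ℝ) ^ ((m : ℝ) / c) := by
      rw [← Real.rpow_natCast]
      refine Real.rpow_le_rpow_of_exponent_le hq1 (Nat.cast_div_le.trans ?_)
      gcongr
    linarith
  have hterm : ∀ p ∈ m.primeFactors, (p : ℝ) * ((q : ℝ) ^ (m / p) + 1) ≤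
      (if p = 3 then 6 * y else 0) + p * (2 * z) := by
    intro p hp
    have hp' := Nat.prime_of_mem_primeFactors hp
    have hodd : Odd p := hm.of_dvd_nat (Nat.dvd_of_mem_primeFactors hp)
    split_ifs with h3
    · subst h3
      have := hpow 3 3 (by norm_num) (by norm_num)
      push_cast
      linarith
    · have h5 : 5 ≤ p := by
        have := hp'.two_le
        obtain ⟨k, rfl⟩ := hodd
        omega
      rw [zero_add]
      exact mul_le_mul_of_nonneg_left (hpow p 5 (by norm_num) (by exact_mod_cast h5))
        p.cast_nonneg
  refine (Finset.sum_le_sum hterm).trans ?_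
  rw [Finset.sum_add_distrib, Finset.sum_ite_eq', ← Finset.sum_mul, ← Nat.cast_sum]
  have h1 : ((∑ p ∈ m.primeFactors, p : ℕ) : ℝ) ≤ m := by exact_mod_cast sum_primeFactors_le hm0
  have h2 : (if 3 ∈ m.primeFactors then 6 * y else 0) ≤ 6 * y := by
    split_ifs
    · exact le_rfl
    · positivity
  nlinarith

end Counting

section UnitaryElements

variable {F K : Type} [Field F] [Fintype F] [Field K] [Algebra F K] [Algebra.IsAlgebraic F K]
  [IsAlgClosed K] [DecidableEq K] {q : ℕ}

/-- For `a` of norm `1`, the elements `α` of `K` with `α ^ (q ^ m + 1) = 1` whose norm from the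
extension of `F` of degree `m` is `a`. -/
noncomputable def unitaryElements (K : Type) [Field K] [Algebra F K] [DecidableEq K]
    (q m : ℕ) (a : F) : Finset K :=
  (nthRoots (unitaryIndex q m) (algebraMap F K a)).toFinset

omit [Fintype F] [Algebra.IsAlgebraic F K] [IsAlgClosed K] in
lemma mem_unitaryElements (hq : 2 ≤ q) {m : ℕ} (hm : Odd m) {a : F} {α : K} :
    α ∈ unitaryElements K q m a ↔ α ^ unitaryIndex q m = algebraMap F K a := by
  rw [unitaryElements, Multiset.mem_toFinset,
    mem_nthRoots (unitaryIndex_pos (one_le_two.trans hq) hm)]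

omit [Algebra.IsAlgebraic F K] in
lemma card_unitaryElements (hcard : Fintype.card F = q ^ 2) (hq : 2 ≤ q) {m : ℕ} (hm : Odd m)
    {a : F} (ha : a ^ (q + 1) = 1) : (unitaryElements K q m a).card = unitaryIndex q m := by
  have hqF : (q : F) = 0 := by
    have := Nat.cast_card_eq_zero F
    rw [hcard, Nat.cast_pow] at this
    exact pow_eq_zero_iff two_ne_zero |>.1 this
  have hqK : (q : K) = 0 := by rw [← map_natCast (algebraMap F K), hqF, map_zero]
  refine card_toFinset_nthRoots ?_ ?_
  · intro h
    have := congrArg (Nat.cast : ℕ → K) (unitaryIndex_mul (one_le_two.trans hq) hm)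
    simp [h, hqK, hm.pos.ne'] at this
  · rw [(map_ne_zero_iff _ (algebraMap F K).injective)]
    rintro rfl
    simp at ha

lemma card_unitaryElements_filter (hcard : Fintype.card F = q ^ 2) (hq : 2 ≤ q) {m d : ℕ}
    (hm : Odd m) (hd : d ∣ m) {a : F} (ha : a ^ (q + 1) = 1) :
    ((unitaryElements K q m a).filter (fun α ↦ (minpoly F α).natDegree ∣ m / d)).card =
      {x : F | x ^ (q + 1) = 1 ∧ x ^ d = a}.ncard * unitaryIndex q (m / d) := by
  classical
  obtain ⟨e, rfl⟩ := hd
  obtain ⟨hd, he⟩ := Nat.odd_mul.1 hm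
  rw [Nat.mul_div_cancel_left e hd.pos]
  have hB : {x : F | x ^ (q + 1) = 1 ∧ x ^ d = a} =
      (Finset.univ.filter (fun x : F ↦ x ^ (q + 1) = 1 ∧ x ^ d = a) : Finset F) := by
    ext
    simp
  rw [hB, Set.ncard_coe_finset]
  have hU : (unitaryElements K q (d * e) a).filter (fun α ↦ (minpoly F α).natDegree ∣ e) =
      (Finset.univ.filter (fun x : F ↦ x ^ (q + 1) = 1 ∧ x ^ d = a)).biUnion
        (unitaryElements K q e) := by
    ext α
    simp only [Finset.mem_filter, Finset.mem_biUnion, mem_unitaryElements hq hm,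
      mem_unitaryElements hq he, Finset.mem_univ, true_and]
    rw [← pow_card_pow_eq_self_iff]
    exact pow_unitaryIndex_mul_eq_iff hcard hq hd he ha α
  rw [hU, Finset.card_biUnion]
  · rw [Finset.sum_const_nat]
    intro b hb
    exact card_unitaryElements hcard hq he (Finset.mem_filter.1 hb).2.1
  · intro b _ c _ hbc
    refine Finset.disjoint_left.2 fun α h1 h2 ↦ hbc ?_
    rw [mem_unitaryElements hq he] at h1 h2
    exact (algebraMap F K).injective (h1.symm.trans h2)

omit [IsAlgClosed K] in
lemma natDegree_minpoly_dvd_of_mem_unitaryElements (hcard : Fintype.card F = q ^ 2) (hq : 2 ≤ q)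
    {m : ℕ} (hm : Odd m) {a : F} (ha : a ^ (q + 1) = 1) {α : K}
    (hα : α ∈ unitaryElements K q m a) : (minpoly F α).natDegree ∣ m := by
  rw [mem_unitaryElements hq hm] at hα
  rw [← pow_card_pow_eq_self_iff]
  have := pow_unitaryIndex_mul_eq_iff hcard hq odd_one hm ha α
  rw [one_mul] at this
  exact (this.2 ⟨a, ⟨ha, pow_one a⟩, hα⟩).2

/-- Each monic irreducible †-symmetric polynomial of degree `m` contributes `m` elements. -/
lemma mul_ncard_isDaggerSymm_eq (hcard : Fintype.card F = q ^ 2) (hq : 2 ≤ q)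
    (φ : K →+* K) (hφ : ∀ x, φ x = x ^ q) (σ : F →+* F) (hσ : ∀ x, σ x = x ^ q) {m : ℕ}
    (hm : Odd m) {a : F} (ha : a ^ (q + 1) = 1) :
    m * {f : F[X] | f.Monic ∧ Irreducible f ∧ IsDaggerSymm σ f ∧ f.natDegree = m ∧
      f.coeff 0 = -a}.ncard =
    ((unitaryElements K q m a).filter (fun α ↦ (minpoly F α).natDegree = m)).card := by
  classical
  set T := (unitaryElements K q m a).filter (fun α ↦ (minpoly F α).natDegree = m) with hT
  have hmemT : ∀ α : K, α ∈ T ↔ IsDaggerSymm σ (minpoly F α) ∧ (minpoly F α).natDegree = m ∧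
      (minpoly F α).coeff 0 = -a := by
    intro α
    rw [hT, Finset.mem_filter, mem_unitaryElements hq hm,
      isDaggerSymm_minpoly_iff hcard φ hφ σ hσ]
    constructor
    · rintro ⟨h, rfl⟩
      have h1 : α ^ (q ^ (minpoly F α).natDegree + 1) = 1 := by
        rw [← pow_unitaryIndex_pow_succ hq hm, h, ← map_pow, ha, map_one]
      refine ⟨⟨hm, h1⟩, rfl, (algebraMap F K).injective ?_⟩
      rw [algebraMap_minpoly_coeff_zero_of_unitary hcard hq hm h1, h, map_neg]
    · rintro ⟨⟨-, h1⟩, rfl, h⟩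
      refine ⟨?_, rfl⟩
      rw [← neg_inj, ← algebraMap_minpoly_coeff_zero_of_unitary hcard hq hm h1, h, map_neg]
  have himage : {f : F[X] | f.Monic ∧ Irreducible f ∧ IsDaggerSymm σ f ∧ f.natDegree = m ∧
      f.coeff 0 = -a} = (T.image (minpoly F) : Finset F[X]) := by
    ext f
    simp only [Set.mem_ofPred_eq, Finset.coe_image, Set.mem_image, Finset.mem_coe, hmemT]
    constructor
    · rintro ⟨h1, h2, h3⟩
      obtain ⟨α, hα⟩ := IsAlgClosed.exists_aeval_eq_zero K f h2.degree_pos.ne'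
      have hf := minpoly.eq_of_irreducible_of_monic h2 hα h1
      exact ⟨α, hf ▸ h3, hf.symm⟩
    · rintro ⟨α, h, rfl⟩
      have hα : IsIntegral F α := Algebra.IsIntegral.isIntegral α
      exact ⟨minpoly.monic hα, minpoly.irreducible hα, h⟩
  rw [himage, Set.ncard_coe_finset, Finset.card_eq_sum_card_image (minpoly F) T,
    Finset.sum_const_nat, mul_comm]
  intro f hf
  obtain ⟨β, hβ, rfl⟩ := Finset.mem_image.1 hf
  have hβi : IsIntegral F β := Algebra.IsIntegral.isIntegral β
  have hroots : T.filter (fun α ↦ minpoly F α = minpoly F β) =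
      ((minpoly F β).aroots K).toFinset := by
    ext α
    rw [Finset.mem_filter, Multiset.mem_toFinset, mem_aroots]
    constructor
    · rintro ⟨-, h⟩
      exact ⟨minpoly.ne_zero hβi, h ▸ minpoly.aeval F α⟩
    · rintro ⟨-, h⟩
      have h := minpoly.eq_of_irreducible_of_monic (minpoly.irreducible hβi) h (minpoly.monic hβi)
      exact ⟨by rw [hmemT, ← h, ← hmemT]; exact hβ, h.symm⟩
  have hdeg := ((hmemT β).1 hβ).2.1
  have hsep : (minpoly F β).Separable :=
    PerfectField.separable_of_irreducible (minpoly.irreducible hβi)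
  rw [hroots, Multiset.toFinset_card_of_nodup (nodup_roots hsep.map),
    ← (IsAlgClosed.splits _).natDegree_eq_card_roots, natDegree_map, hdeg]

end UnitaryElements

lemma ncard_pow_eq_le {F : Type} [Field F] (q : ℕ) {d : ℕ} (hd : 0 < d) (a : F) :
    {x : F | x ^ (q + 1) = 1 ∧ x ^ d = a}.ncard ≤ d := by
  classical
  have hsub : {x : F | x ^ (q + 1) = 1 ∧ x ^ d = a} ⊆ ((nthRoots d a).toFinset : Finset F) := by
    rintro x ⟨-, hx⟩
    rw [Finset.mem_coe, Multiset.mem_toFinset, mem_nthRoots hd]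
    exact hx
  refine (Set.ncard_le_ncard hsub (Finset.finite_toSet _)).trans ?_
  rw [Set.ncard_coe_finset]
  exact (Multiset.toFinset_card_le _).trans (card_nthRoots d a)

/-- **Prime polynomial theorem for †-symmetric polynomials.**
Over a field `F` with `q0²` elements with involution `x ↦ x^{q0}`, every †-symmetric monic
irreducible polynomial has odd degree and constant coefficient in the subgroup `U` of order
`q0 + 1`; moreover for `a ∈ U` the number of †-symmetric monic irreducibles of degree `2n - 1`
with constant coefficient `-a` equals
`(1/(2n-1)) ∑_{d ∣ 2n-1} μ(d) r_d(a) (q0^{(2n-1)/d} + 1)/(q0 + 1)`,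
and equals `(q0^{2n-1} + 1 - ε q0^{(2n-1)/3})/((2n-1)(q0+1))` with `0 ≤ ε ≤ 40`. -/
theorem stmt2 (F : Type) [Field F] [Fintype F] (q0 : ℕ) (hq0 : IsPrimePow q0)
    (hcard : Fintype.card F = q0 ^ 2) (σ : F →+* F) (hσ : ∀ x : F, σ x = x ^ q0) :
    (∀ f : F[X], f.Monic → Irreducible f → IsDaggerSymm σ f →
      Odd f.natDegree ∧ (f.coeff 0) ^ (q0 + 1) = 1) ∧
    ∀ n : ℕ, 1 ≤ n → ∀ a : F, a ^ (q0 + 1) = 1 →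
      (({f : F[X] | f.Monic ∧ Irreducible f ∧ IsDaggerSymm σ f ∧ f.natDegree = 2 * n - 1 ∧
          f.coeff 0 = -a}.ncard : ℝ) =
        (1 / ((2 * n - 1 : ℕ) : ℝ)) * ∑ d ∈ (2 * n - 1).divisors,
          (ArithmeticFunction.moebius d : ℝ) *
            ({x : F | x ^ (q0 + 1) = 1 ∧ x ^ d = a}.ncard : ℝ) *
            (((q0 : ℝ) ^ ((2 * n - 1) / d) + 1) / ((q0 : ℝ) + 1))) ∧
      ∃ ε : ℝ, 0 ≤ ε ∧ ε ≤ 40 ∧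
        ({f : F[X] | f.Monic ∧ Irreducible f ∧ IsDaggerSymm σ f ∧ f.natDegree = 2 * n - 1 ∧
            f.coeff 0 = -a}.ncard : ℝ) =
          ((q0 : ℝ) ^ (2 * n - 1) + 1 - ε * (q0 : ℝ) ^ (((2 * n - 1 : ℕ) : ℝ) / 3)) /
            (((2 * n - 1 : ℕ) : ℝ) * ((q0 : ℝ) + 1)) := by
  classical
  have hq : 2 ≤ q0 := hq0.two_le
  let K := AlgebraicClosure F
  obtain ⟨φ, hφ⟩ : ∃ φ : K →+* K, ∀ x, φ x = x ^ q0 := by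
    obtain ⟨p, k, hp, -, hpk⟩ := hq0
    have : Fact p.Prime := ⟨hp.nat_prime⟩
    have : CharP F p := charP_of_card_eq_prime_pow (f := k * 2) (by rw [hcard, ← hpk, pow_mul])
    have : CharP K p := charP_of_injective_algebraMap (algebraMap F K).injective p
    exact ⟨iterateFrobenius K p k, fun x ↦ by rw [iterateFrobenius_def, hpk]⟩
  refine ⟨fun f hf hirr hsymm ↦ ?_, fun n hn a ha ↦ ?_⟩
  · obtain ⟨α, hα⟩ := IsAlgClosed.exists_aeval_eq_zero K f hirr.degree_pos.ne'
    obtain rfl := minpoly.eq_of_irreducible_of_monic hirr hα hf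
    obtain ⟨hodd, h1⟩ := (isDaggerSymm_minpoly_iff hcard φ hφ σ hσ α).1 hsymm
    refine ⟨hodd, (algebraMap F K).injective ?_⟩
    have hneg : (-1 : K) ^ (q0 + 1) = 1 := by
      rw [pow_succ, ← hφ, map_neg, map_one]
      ring
    rw [map_pow, algebraMap_minpoly_coeff_zero_of_unitary hcard hq hodd h1, neg_pow, hneg,
      pow_unitaryIndex_pow_succ hq hodd, h1, one_mul, map_one]
  · obtain ⟨m, hmn⟩ : ∃ m, m = 2 * n - 1 := ⟨_, rfl⟩
    rw [← hmn]
    have hm : Odd m := ⟨n - 1, by omega⟩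
    have hm0 : m ≠ 0 := hm.pos.ne'
    have hmR : (m : ℝ) ≠ 0 := by exact_mod_cast hm0
    have hq1 : (0 : ℝ) < (q0 : ℝ) + 1 := by positivity
    have hk : ∀ e, Odd e → (unitaryIndex q0 e : ℝ) = ((q0 : ℝ) ^ e + 1) / ((q0 : ℝ) + 1) := by
      intro e he
      rw [eq_div_iff hq1.ne']
      exact_mod_cast unitaryIndex_mul (one_le_two.trans hq) he
    have hodd : ∀ d, d ∣ m → Odd (m / d) := fun d hd ↦ hm.of_dvd_nat (Nat.div_dvd_of_dvd hd)
    have hN := mul_ncard_isDaggerSymm_eq hcard hq φ hφ σ hσ hm ha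
    set N := {f : F[X] | f.Monic ∧ Irreducible f ∧ IsDaggerSymm σ f ∧ f.natDegree = m ∧
      f.coeff 0 = -a}.ncard
    have hδ : ∀ α ∈ unitaryElements K q0 m a, (minpoly F α).natDegree ∣ m := fun α hα ↦
      natDegree_minpoly_dvd_of_mem_unitaryElements hcard hq hm ha hα
    have hfilter : ∀ d, d ∣ m → (((unitaryElements K q0 m a).filter
        (fun α ↦ (minpoly F α).natDegree ∣ m / d)).card : ℝ) =
        ({x : F | x ^ (q0 + 1) = 1 ∧ x ^ d = a}.ncard : ℝ) *
          (((q0 : ℝ) ^ (m / d) + 1) / ((q0 : ℝ) + 1)) := by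
      intro d hd
      rw [card_unitaryElements_filter hcard hq hm hd ha, Nat.cast_mul, hk _ (hodd d hd)]
    constructor
    · have h := card_filter_eq_sum_moebius _ _ hm0 hδ
      rw [← hN] at h
      have h' := congrArg (Int.cast : ℤ → ℝ) h
      push_cast at h'
      rw [one_div, eq_inv_mul_iff_mul_eq₀ hmR, h']
      refine Finset.sum_congr rfl fun d hd ↦ ?_
      rw [hfilter d (Nat.dvd_of_mem_divisors hd), mul_assoc]
    · set y := (q0 : ℝ) ^ ((m : ℝ) / 3)
      have hy : 0 < y := Real.rpow_pos_of_pos (by exact_mod_cast one_le_two.trans hq) _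
      have hcardS : ((unitaryElements K q0 m a).card : ℝ) * (q0 + 1) = (q0 : ℝ) ^ m + 1 := by
        rw [card_unitaryElements hcard hq hm ha, hk m hm, div_mul_cancel₀ _ hq1.ne']
      have hle : (m : ℝ) * N ≤ (unitaryElements K q0 m a).card := by
        have := Finset.card_filter_le (unitaryElements K q0 m a)
          (fun α ↦ (minpoly F α).natDegree = m)
        rw [← hN] at this
        exact_mod_cast this
      have hge : ((unitaryElements K q0 m a).card : ℝ) ≤ m * N +
          (∑ p ∈ m.primeFactors, (p : ℝ) * ((q0 : ℝ) ^ (m / p) + 1)) / (q0 + 1) := by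
        have h := card_le_card_filter_add_sum_primeFactors _ _ hm0 hδ
        rw [← hN] at h
        have h' : ((unitaryElements K q0 m a).card : ℝ) ≤ m * N + ∑ p ∈ m.primeFactors,
            (((unitaryElements K q0 m a).filter
              (fun α ↦ (minpoly F α).natDegree ∣ m / p)).card : ℝ) := by exact_mod_cast h
        refine h'.trans (add_le_add_right ?_ _)
        rw [Finset.sum_div]
        refine Finset.sum_le_sum fun p hp ↦ ?_
        rw [hfilter p (Nat.dvd_of_mem_primeFactors hp), mul_div_assoc]
        refine mul_le_mul_of_nonneg_right ?_ (by positivity)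
        exact_mod_cast ncard_pow_eq_le q0 (Nat.pos_of_mem_primeFactors hp) a
      refine ⟨((q0 : ℝ) ^ m + 1 - m * N * (q0 + 1)) / y, div_nonneg ?_ hy.le, ?_, ?_⟩
      · rw [← hcardS, ← sub_mul]
        exact mul_nonneg (sub_nonneg.2 hle) hq1.le
      · rw [div_le_iff₀ hy, ← hcardS]
        have h1 := mul_le_mul_of_nonneg_right hge hq1.le
        rw [add_mul, div_mul_cancel₀ _ hq1.ne'] at h1
        linarith [sum_primeFactors_mul_le hq hm]
      · rw [div_mul_cancel₀ _ hy.ne', sub_sub_cancel, eq_div_iff (by positivity)]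
        ring
end

section
/- There is an absolute constant C > 0 with the following property. Let F be a finite field with q elements, let n ≥ 1, let I_1, …, I_r be a partition of the set of *-irreducible polynomials over F of degree ≤ 2n, and let m_1, …, m_r ≥ 0 be integers such that m_i = 0 whenever I_i is empty. Then the number of squarefree *-symmetric monic polynomials f of degree 2n over F with constant coefficient 1 having exactly m_i distinct *-irreducible factors in I_i for each i is at most C·q^n·∏_{i=1}^r ( e^{−H*(I_i)}·H*(I_i)^{m_i}/m_i! )·( m_1/H*(I_1) + ⋯ + m_r/H*(I_r) ), where terms m_i/H*(I_i) with m_i = 0 are interpreted as 0. -/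
open Polynomial

/-- `f` is *-symmetric: `f(0) ≠ 0` and `f* = f`, where `f*(X) = Xⁿ f(1/X)/f(0)`. -/
def IsStarSymm {F : Type} [Field F] (f : F[X]) : Prop :=
  f.coeff 0 ≠ 0 ∧ f.reverse = Polynomial.C (f.coeff 0) * f

/-- A monic *-symmetric polynomial of positive degree is *-irreducible if it has no proper
*-symmetric monic divisor of positive degree. -/
def IsStarIrreducible {F : Type} [Field F] (f : F[X]) : Prop :=
  f.Monic ∧ 0 < f.natDegree ∧ IsStarSymm f ∧
    ∀ g : F[X], g.Monic → IsStarSymm g → g ∣ f →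
      0 < g.natDegree → g.natDegree < f.natDegree → False

/-- `H*(I) = ∑_{g ∈ I} q^{-(deg g)/2}`. -/
noncomputable def polyHstar (q : ℕ) {F : Type} [Field F] (I : Set F[X]) : ℝ :=
  ∑ᶠ g ∈ I, ((q : ℝ) ^ ((g.natDegree : ℝ) / 2))⁻¹

namespace IsStarSymm

variable {F : Type} [Field F] {f g a : F[X]}

lemma of_mul_left (hf : IsStarSymm (g * a)) (hg : IsStarSymm g) : IsStarSymm a := by
  have h0 := hf.1
  rw [mul_coeff_zero] at h0
  refine ⟨right_ne_zero_of_mul h0, ?_⟩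
  have h := hf.2
  have hgne : g ≠ 0 := fun h => hg.1 (by simp [h])
  have hc : C (g.coeff 0) * g ≠ 0 := mul_ne_zero (by simpa using hg.1) hgne
  rw [reverse_mul_of_domain, hg.2, mul_coeff_zero, C_mul] at h
  refine mul_left_cancel₀ hc (h.trans ?_)
  ring

lemma reverse_dvd (hf : IsStarSymm f) (h : g ∣ f) : g.reverse ∣ f := by
  obtain ⟨a, rfl⟩ := h
  have h1 : g.reverse ∣ C ((g * a).coeff 0) * (g * a) := by
    rw [← hf.2, reverse_mul_of_domain]
    exact dvd_mul_right _ _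
  have hu : IsUnit (C ((g * a).coeff 0)) := isUnit_C.2 (isUnit_iff_ne_zero.2 hf.1)
  exact (hu.dvd_mul_left).1 h1

/-- A monic polynomial with nonzero constant coefficient whose reverse divides it is symmetric. -/
lemma of_reverse_dvd (hm : f.Monic) (h0 : f.coeff 0 ≠ 0) (h : f.reverse ∣ f) : IsStarSymm f := by
  have hdeg : f.reverse.natDegree = f.natDegree := by
    rw [reverse_natDegree, natTrailingDegree_eq_zero.2 (Or.inr h0), Nat.sub_zero]
  have hlc : f.reverse.leadingCoeff = f.coeff 0 := by
    rw [Polynomial.reverse_leadingCoeff, trailingCoeff,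
      natTrailingDegree_eq_zero.2 (Or.inr h0)]
  refine ⟨h0, ?_⟩
  obtain ⟨b, hb⟩ := h
  have hr : f.reverse ≠ 0 := by simpa using hm.ne_zero
  have hb0 : b ≠ 0 := by
    rintro rfl
    exact hm.ne_zero (by simpa using hb)
  have hbd : b.natDegree = 0 := by
    have := congrArg natDegree hb
    rw [natDegree_mul hr hb0] at this
    omega
  rw [eq_C_of_natDegree_eq_zero hbd] at hb
  have hl := congrArg leadingCoeff hb
  rw [hm.leadingCoeff, leadingCoeff_mul, hlc, leadingCoeff_C] at hl
  calc f.reverse = f.reverse * C (f.coeff 0 * b.coeff 0) := by rw [← hl, C_1, mul_one]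
    _ = C (f.coeff 0) * (f.reverse * C (b.coeff 0)) := by rw [C_mul]; ring
    _ = C (f.coeff 0) * f := by rw [← hb]

end IsStarSymm

namespace IsStarIrreducible

variable {F : Type} [Field F] {f g a : F[X]}

lemma eq_of_dvd (hg : IsStarIrreducible g) (hm : a.Monic) (ha : IsStarSymm a) (h : a ∣ g)
    (hd : 0 < a.natDegree) : a = g := by
  have hle : g.natDegree ≤ a.natDegree := by
    by_contra! hlt
    exact hg.2.2.2 a hm ha h hd hlt
  exact (eq_of_monic_of_dvd_of_natDegree_le hm hg.1 h hle).symm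

lemma isCoprime (hf : IsStarIrreducible f) (hg : IsStarIrreducible g) (hne : f ≠ g) :
    IsCoprime f g := by
  classical
  rw [← EuclideanDomain.gcd_isUnit_iff]
  set k := normalize (EuclideanDomain.gcd f g) with hk
  have hgcd : EuclideanDomain.gcd f g ≠ 0 := fun h =>
    hf.1.ne_zero (EuclideanDomain.gcd_eq_zero_iff.1 h).1
  have hkm : k.Monic := monic_normalize hgcd
  have hkf : k ∣ f := normalize_dvd_iff.2 (EuclideanDomain.gcd_dvd_left f g)
  have hkg : k ∣ g := normalize_dvd_iff.2 (EuclideanDomain.gcd_dvd_right f g)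
  have hk0 : k.coeff 0 ≠ 0 := by
    intro h
    obtain ⟨b, hb⟩ := hkf
    exact hf.2.2.1.1 (by rw [hb, mul_coeff_zero, h, zero_mul])
  have hks : IsStarSymm k := IsStarSymm.of_reverse_dvd hkm hk0
    (dvd_normalize_iff.2 (EuclideanDomain.dvd_gcd (hf.2.2.1.reverse_dvd hkf)
      (hg.2.2.1.reverse_dvd hkg)))
  have hkd : k.natDegree = 0 := by
    by_contra hd
    exact hne ((hf.eq_of_dvd hkm hks hkf (Nat.pos_of_ne_zero hd)).symm.trans
      (hg.eq_of_dvd hkm hks hkg (Nat.pos_of_ne_zero hd)))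
  have hk1 : k = 1 := hkm.natDegree_eq_zero.1 hkd
  exact normalize_eq_one.1 hk1

/-- A monic *-symmetric polynomial of positive degree has a *-irreducible divisor. -/
lemma exists_dvd (hm : f.Monic) (hf : IsStarSymm f) (hd : 0 < f.natDegree) :
    ∃ g, IsStarIrreducible g ∧ g ∣ f := by
  classical
  let P : ℕ → Prop := fun k =>
    ∃ g : F[X], g.Monic ∧ IsStarSymm g ∧ g ∣ f ∧ 0 < g.natDegree ∧ g.natDegree = k
  have hP : ∃ k, P k := ⟨_, f, hm, hf, dvd_rfl, hd, rfl⟩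
  obtain ⟨g, hgm, hgs, hgf, hgd, hgk⟩ := Nat.find_spec hP
  refine ⟨g, ⟨hgm, hgd, hgs, fun b hbm hbs hbg hbd hlt => ?_⟩, hgf⟩
  exact Nat.find_min hP (hgk ▸ hlt) ⟨b, hbm, hbs, hbg.trans hgf, hbd, rfl⟩

/-- A squarefree monic *-symmetric polynomial is the product of its *-irreducible divisors. -/
lemma prod_eq_of_squarefree (hm : f.Monic) (hs : Squarefree f) (hf : IsStarSymm f)
    (S : Finset F[X]) (hS : ∀ g, g ∈ S ↔ IsStarIrreducible g ∧ g ∣ f) : ∏ g ∈ S, g = f := by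
  classical
  induction hn : f.natDegree using Nat.strong_induction_on generalizing f S with
  | _ n ih =>
    rcases Nat.eq_zero_or_pos f.natDegree with h0 | hpos
    · have hf1 := hm.natDegree_eq_zero.1 h0
      subst hf1
      have : S = ∅ := by
        refine Finset.eq_empty_of_forall_notMem fun g hg => ?_
        obtain ⟨hgi, hg1⟩ := (hS g).1 hg
        have := natDegree_le_of_dvd hg1 one_ne_zero
        have := hgi.2.1
        simp at *
        omega
      simp [this]
    · obtain ⟨g, hg, a, rfl⟩ := exists_dvd hm hf hpos
      have ham : a.Monic := hg.1.of_mul_monic_left hm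
      have hnd : ¬ g ∣ a := fun h => by
        have := hs g (mul_dvd_mul_left g h)
        exact hg.2.1.ne' (natDegree_eq_zero_of_isUnit this)
      have hgS : g ∈ S := (hS g).2 ⟨hg, dvd_mul_right _ _⟩
      rw [← Finset.mul_prod_erase S _ hgS]
      congr 1
      refine ih a.natDegree ?_ ham (hs.squarefree_of_dvd (dvd_mul_left _ _))
        (hf.of_mul_left hg.2.2.1) (S.erase g) ?_ rfl
      · rw [← hn, hg.1.natDegree_mul ham]
        have := hg.2.1
        omega
      · intro b
        rw [Finset.mem_erase, hS]
        constructor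
        · rintro ⟨hbg, hb, hbd⟩
          exact ⟨hb, (hb.isCoprime hg hbg).dvd_of_dvd_mul_left hbd⟩
        · rintro ⟨hb, hbd⟩
          exact ⟨fun h => hnd (h ▸ hbd), hb, hbd.trans (dvd_mul_left _ _)⟩

end IsStarIrreducible

section QuadraticTransform

variable {F : Type} [Field F]

/-- The polynomial `X ^ d * h (X + 1 / X)`, for `h` of degree at most `d`. -/
noncomputable def quadTransform (d : ℕ) (h : F[X]) : F[X] :=
  ∑ i ∈ Finset.range (d + 1), C (h.coeff i) * ((X ^ 2 + 1) ^ i * X ^ (d - i))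

lemma algebraMap_quadTransform {d : ℕ} {h : F[X]} (hd : h.natDegree ≤ d) :
    algebraMap F[X] (RatFunc F) (quadTransform d h) =
      RatFunc.X ^ d * eval₂ (algebraMap F (RatFunc F)) (RatFunc.X + RatFunc.X⁻¹) h := by
  rw [quadTransform, eval₂_eq_sum_range' _ (Nat.lt_succ_of_le hd), map_sum, Finset.mul_sum]
  refine Finset.sum_congr rfl fun i hi => ?_
  have hid : i ≤ d := Nat.lt_succ_iff.1 (Finset.mem_range.1 hi)
  have hX : (RatFunc.X : RatFunc F) ≠ 0 := RatFunc.X_ne_zero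
  have hq : (RatFunc.X : RatFunc F) ^ 2 + 1 = RatFunc.X * (RatFunc.X + RatFunc.X⁻¹) := by
    field_simp
  simp only [map_mul, map_pow, map_add, map_one, RatFunc.algebraMap_X, RatFunc.algebraMap_C]
  rw [hq, mul_pow]
  conv_rhs => rw [← Nat.add_sub_cancel' hid, pow_add]
  rw [RatFunc.algebraMap_eq_C]
  ring

lemma quadTransform_mul {d e : ℕ} {h k : F[X]} (hd : h.natDegree ≤ d) (hk : k.natDegree ≤ e) :
    quadTransform (d + e) (h * k) = quadTransform d h * quadTransform e k := by
  apply RatFunc.algebraMap_injective F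
  rw [map_mul, algebraMap_quadTransform hd, algebraMap_quadTransform hk,
    algebraMap_quadTransform (natDegree_mul_le.trans (add_le_add hd hk)), eval₂_mul]
  ring

lemma natDegree_X_sq_add_one_pow (i : ℕ) : ((X ^ 2 + 1 : F[X]) ^ i).natDegree = 2 * i := by
  rw [natDegree_pow, ← C_1, natDegree_X_pow_add_C, mul_comm]

lemma reflect_X_sq_add_one_pow (i : ℕ) :
    reflect (2 * i) ((X ^ 2 + 1 : F[X]) ^ i) = (X ^ 2 + 1) ^ i := by
  induction i with
  | zero => simp
  | succ i ih =>
    have h2 : reflect 2 (X ^ 2 + 1 : F[X]) = X ^ 2 + 1 := by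
      rw [reflect_add, reflect_one, reflect_monomial, revAt_le le_rfl, Nat.sub_self, pow_zero,
        add_comm]
    rw [pow_succ, mul_add, mul_one, reflect_mul _ _ (natDegree_X_sq_add_one_pow i).le
      (by simpa using (natDegree_X_sq_add_one_pow (F := F) 1).le), ih, h2]

lemma natDegree_quadTransform_le (d : ℕ) (h : F[X]) : (quadTransform d h).natDegree ≤ 2 * d := by
  refine natDegree_sum_le_of_forall_le _ _ fun i hi => ?_
  have hid : i ≤ d := Nat.lt_succ_iff.1 (Finset.mem_range.1 hi)
  refine (natDegree_C_mul_le _ _).trans (natDegree_mul_le.trans ?_)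
  rw [natDegree_X_sq_add_one_pow, natDegree_X_pow]
  omega

lemma reflect_quadTransform (d : ℕ) (h : F[X]) :
    reflect (2 * d) (quadTransform d h) = quadTransform d h := by
  let φ : F[X] →+ F[X] := ⟨⟨reflect (2 * d), reflect_zero⟩, fun f g => reflect_add f g _⟩
  rw [quadTransform]
  change φ (∑ i ∈ Finset.range (d + 1), C (h.coeff i) * ((X ^ 2 + 1) ^ i * X ^ (d - i))) = _
  refine (map_sum φ _ _).trans (Finset.sum_congr rfl fun i hi => ?_)
  have hid : i ≤ d := Nat.lt_succ_iff.1 (Finset.mem_range.1 hi)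
  change reflect (2 * d) (C (h.coeff i) * ((X ^ 2 + 1) ^ i * X ^ (d - i))) = _
  rw [reflect_C_mul, show 2 * d = 2 * i + 2 * (d - i) by omega,
    reflect_mul _ _ (natDegree_X_sq_add_one_pow i).le (by rw [natDegree_X_pow]; omega),
    reflect_X_sq_add_one_pow, reflect_monomial, revAt_le (by omega),
    show 2 * (d - i) - (d - i) = d - i by omega]

lemma coeff_zero_quadTransform (d : ℕ) (h : F[X]) :
    (quadTransform d h).coeff 0 = h.coeff d := by
  rw [quadTransform, finsetSum_coeff, Finset.sum_range_succ, Finset.sum_eq_zero, zero_add]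
  · simp [coeff_zero_eq_eval_zero]
  · intro i hi
    have hid : d - i ≠ 0 := by
      have := Finset.mem_range.1 hi
      omega
    simp [coeff_zero_eq_eval_zero, hid]

lemma coeff_quadTransform_two_mul (d : ℕ) (h : F[X]) :
    (quadTransform d h).coeff (2 * d) = h.coeff d := by
  rw [← coeff_zero_quadTransform d h]
  nth_rw 1 [← reflect_quadTransform d h]
  rw [coeff_reflect, revAt_le le_rfl, Nat.sub_self]

lemma natDegree_quadTransform {h : F[X]} (hm : h.Monic) :
    (quadTransform h.natDegree h).natDegree = 2 * h.natDegree := by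
  refine le_antisymm (natDegree_quadTransform_le _ _) (le_natDegree_of_ne_zero ?_)
  rw [coeff_quadTransform_two_mul, coeff_natDegree, hm.leadingCoeff]
  exact one_ne_zero

lemma monic_quadTransform {h : F[X]} (hm : h.Monic) : (quadTransform h.natDegree h).Monic := by
  rw [Monic, leadingCoeff, natDegree_quadTransform hm, coeff_quadTransform_two_mul,
    coeff_natDegree, hm.leadingCoeff]

lemma isStarSymm_quadTransform {h : F[X]} (hm : h.Monic) :
    IsStarSymm (quadTransform h.natDegree h) := by
  have h0 : (quadTransform h.natDegree h).coeff 0 = 1 := by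
    rw [coeff_zero_quadTransform, coeff_natDegree, hm.leadingCoeff]
  refine ⟨by rw [h0]; exact one_ne_zero, ?_⟩
  rw [h0, C_1, one_mul, reverse, natDegree_quadTransform hm, reflect_quadTransform]

lemma quadTransform_add_C_mul_X_pow {d : ℕ} {h : F[X]} (hd : h.natDegree ≤ d) (c : F) :
    quadTransform (d + 1) (h + C c * X ^ (d + 1)) =
      X * quadTransform d h + C c * (X ^ 2 + 1) ^ (d + 1) := by
  have hz : h.coeff (d + 1) = 0 := coeff_eq_zero_of_natDegree_lt (Nat.lt_succ_of_le hd)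
  rw [quadTransform, Finset.sum_range_succ, quadTransform, Finset.mul_sum]
  congr 1
  · refine Finset.sum_congr rfl fun i hi => ?_
    have hid := Finset.mem_range.1 hi
    rw [coeff_add, coeff_C_mul_X_pow, if_neg (by omega), add_zero,
      show d + 1 - i = (d - i) + 1 by omega, pow_succ]
    ring
  · simp [hz]

lemma exists_quadTransform_eq (d : ℕ) (p : F[X]) (hp : p.natDegree ≤ 2 * d)
    (hr : reflect (2 * d) p = p) : ∃ h : F[X], h.natDegree ≤ d ∧ quadTransform d h = p := by
  induction d generalizing p with
  | zero =>
    refine ⟨p, by simpa using hp, ?_⟩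
    rw [mul_zero] at hp
    rw [quadTransform]
    simpa using (eq_C_of_natDegree_le_zero hp).symm
  | succ d ih =>
    set c := p.coeff 0 with hc
    set r := p - C c * (X ^ 2 + 1) ^ (d + 1) with hrdef
    have hr0 : r.coeff 0 = 0 := by
      simp [hrdef, hc, coeff_zero_eq_eval_zero]
    have hrr : reflect (2 * (d + 1)) r = r := by
      rw [hrdef, reflect_sub, reflect_C_mul, reflect_X_sq_add_one_pow, hr]
    have hrd : r.natDegree ≤ 2 * (d + 1) :=
      (natDegree_sub_le_of_le hp ((natDegree_C_mul_le _ _).trans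
        (natDegree_X_sq_add_one_pow (d + 1)).le)).trans (max_self _).le
    obtain ⟨s, hs⟩ := X_dvd_iff.2 hr0
    have hcoeff : ∀ i, i ≤ 2 * (d + 1) → r.coeff i = r.coeff (2 * (d + 1) - i) := by
      intro i hi
      conv_lhs => rw [← hrr, coeff_reflect, revAt_le hi]
    have hsd : s.natDegree ≤ 2 * d := by
      rw [natDegree_le_iff_coeff_eq_zero]
      intro N hN
      have h1 : s.coeff N = r.coeff (N + 1) := by rw [hs, coeff_X_mul]
      rw [h1]
      rcases (show N + 1 = 2 * (d + 1) ∨ 2 * (d + 1) < N + 1 by omega) with h | h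
      · rw [h, hcoeff _ le_rfl, Nat.sub_self, hr0]
      · exact coeff_eq_zero_of_natDegree_lt (hrd.trans_lt h)
    have hsr : reflect (2 * d) s = s := by
      ext i
      rw [coeff_reflect]
      rcases le_or_gt i (2 * d) with hi | hi
      · rw [revAt_le hi, ← coeff_X_mul s, ← coeff_X_mul s, ← hs, hcoeff (i + 1) (by omega)]
        congr 1
        omega
      · rw [revAt_eq_self_of_lt hi]
    obtain ⟨h, hhd, hhs⟩ := ih s hsd hsr
    refine ⟨h + C c * X ^ (d + 1), ?_, ?_⟩
    · exact (natDegree_add_le_of_le (hhd.trans (Nat.le_succ d))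
        (natDegree_C_mul_X_pow_le _ _)).trans (max_self _).le
    · rw [quadTransform_add_C_mul_X_pow hhd, hhs, ← hs, hrdef]
      ring

end QuadraticTransform

section Classification

variable {F : Type} [Field F] {g : F[X]}

lemma IsStarSymm.coeff_revAt {f : F[X]} (hf : IsStarSymm f) {i : ℕ} (hi : i ≤ f.natDegree) :
    f.coeff (f.natDegree - i) = f.coeff 0 * f.coeff i := by
  have h := congrArg (fun p => coeff p i) hf.2
  simpa [coeff_reverse, revAt_le hi] using h

lemma isStarSymm_X_sub_C {a : F} (ha : a * a = 1) : IsStarSymm (X - C a) := by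
  have ha0 : a ≠ 0 := left_ne_zero_of_mul (ha ▸ one_ne_zero)
  refine ⟨by simpa using ha0, ?_⟩
  have h1 : reverse (X - C a) = 1 - C a * X := by
    rw [reverse, natDegree_X_sub_C, reflect_sub, reflect_one_X, reflect_C, pow_one]
  have h2 : (X - C a).coeff 0 = -a := by simp
  rw [h1, h2, C_neg, mul_sub, neg_mul, neg_mul, ← C_mul, ha, C_1]
  ring

lemma IsStarIrreducible.eq_X_sub_C (hg : IsStarIrreducible g) {a : F} (ha : a * a = 1)
    (h : g.eval a = 0) : g = X - C a :=
  (hg.eq_of_dvd (monic_X_sub_C a) (isStarSymm_X_sub_C ha) (dvd_iff_isRoot.2 h)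
    (by rw [natDegree_X_sub_C]; exact one_pos)).symm

/-- A *-irreducible polynomial is `X - 1`, `X + 1`, or has even degree and constant
coefficient `1`. -/
lemma IsStarIrreducible.classification (hg : IsStarIrreducible g) :
    g = X - C 1 ∨ g = X - C (-1) ∨ (Even g.natDegree ∧ g.coeff 0 = 1) := by
  have hs := hg.2.2.1
  by_cases h1 : g.coeff 0 = 1
  · rcases Nat.even_or_odd g.natDegree with he | ho
    · exact Or.inr (Or.inr ⟨he, h1⟩)
    · refine Or.inr (Or.inl (hg.eq_X_sub_C (by ring) ?_))
      rw [eval_eq_sum_range]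
      refine Finset.sum_involution (fun i _ => g.natDegree - i) ?_ ?_ ?_ ?_
      · intro i hi
        have hi' : i ≤ g.natDegree := Nat.lt_succ_iff.1 (Finset.mem_range.1 hi)
        rw [hs.coeff_revAt hi', h1, one_mul, ← mul_add]
        rcases Nat.even_or_odd i with hie | hio
        · rw [hie.neg_one_pow, (Nat.Odd.sub_even hi' ho hie).neg_one_pow]
          ring
        · rw [hio.neg_one_pow, (Nat.Odd.sub_odd ho hio).neg_one_pow]
          ring
      · intro i hi _ h
        have hi' : i ≤ g.natDegree := Nat.lt_succ_iff.1 (Finset.mem_range.1 hi)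
        obtain ⟨k, hk⟩ := ho
        omega
      · intro i hi
        exact Finset.mem_range.2 (by omega)
      · intro i hi
        have hi' : i ≤ g.natDegree := Nat.lt_succ_iff.1 (Finset.mem_range.1 hi)
        change g.natDegree - (g.natDegree - i) = i
        omega
  · left
    refine hg.eq_X_sub_C (by ring) ?_
    have h := hs.2
    have hev : g.reverse.eval 1 = g.eval 1 := by
      let _ : Invertible (1 : F) := invertibleOne
      have := eval₂_reverse_mul_pow (RingHom.id F) 1 g
      simpa [eval₂_id] using this
    have h2 := congrArg (eval 1) h
    rw [hev, eval_mul, eval_C] at h2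
    have h3 : (1 - g.coeff 0) * g.eval 1 = 0 := by linear_combination h2
    exact (mul_eq_zero.1 h3).resolve_left (sub_ne_zero.2 (Ne.symm h1))

/-- *-irreducible polynomials of degree `2 * d` come from irreducible polynomials of degree `d`. -/
lemma IsStarIrreducible.exists_irreducible (hg : IsStarIrreducible g) {d : ℕ} (hd : 0 < d)
    (hgd : g.natDegree = 2 * d) :
    ∃ h : F[X], h.Monic ∧ Irreducible h ∧ h.natDegree = d ∧ quadTransform d h = g := by
  have h0 : g.coeff 0 = 1 := by
    rcases hg.classification with h | h | h
    · rw [h, natDegree_X_sub_C] at hgd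
      omega
    · rw [h, natDegree_X_sub_C] at hgd
      omega
    · exact h.2
  have hrefl : reflect (2 * d) g = g := by
    have := hg.2.2.1.2
    rwa [h0, C_1, one_mul, reverse, hgd] at this
  obtain ⟨h, hhd, hhg⟩ := exists_quadTransform_eq d g hgd.le hrefl
  have hc : h.coeff d = 1 := by rw [← coeff_zero_quadTransform, hhg, h0]
  have hdeg : h.natDegree = d :=
    le_antisymm hhd (le_natDegree_of_ne_zero (hc ▸ one_ne_zero))
  have hm : h.Monic := by rw [Monic, leadingCoeff, hdeg, hc]
  refine ⟨h, hm, ?_, hdeg, hhg⟩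
  rw [hm.irreducible_iff_natDegree']
  refine ⟨fun h1 => by simp [h1] at hdeg; omega, fun a b ha hb hab hbd => ?_⟩
  rw [Finset.mem_Ioc] at hbd
  have hsum : a.natDegree + b.natDegree = d := by rw [← ha.natDegree_mul hb, hab, hdeg]
  have hdvd : quadTransform b.natDegree b ∣ g := by
    rw [← hhg, ← hsum, ← hab, quadTransform_mul le_rfl le_rfl]
    exact dvd_mul_left _ _
  refine hg.2.2.2 _ (monic_quadTransform hb) (isStarSymm_quadTransform hb) hdvd ?_ ?_
  · rw [natDegree_quadTransform hb]; omega
  · rw [natDegree_quadTransform hb]; omega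

lemma card_starIrreducible_of_odd_le {k : ℕ} (hk : Odd k) (S : Finset F[X])
    (hS : ∀ g ∈ S, IsStarIrreducible g ∧ g.natDegree = k) :
    S.card ≤ 2 ∧ (k ≠ 1 → S = ∅) := by
  classical
  have hsub : ∀ g ∈ S, g = X - C 1 ∨ g = X - C (-1) := fun g hg => by
    rcases (hS g hg).1.classification with h | h | h
    · exact Or.inl h
    · exact Or.inr h
    · rw [(hS g hg).2] at h
      exact absurd hk (Nat.not_odd_iff_even.2 h.1)
  constructor
  · refine (Finset.card_le_card (t := {X - C 1, X - C (-1)}) fun g hg => ?_).trans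
      Finset.card_le_two
    simpa using hsub g hg
  · intro hk1
    refine Finset.eq_empty_of_forall_notMem fun g hg => hk1 ?_
    rw [← (hS g hg).2]
    rcases hsub g hg with h | h <;> rw [h, natDegree_X_sub_C]

end Classification

section Counting

variable {F : Type} [Field F] [Fintype F]

lemma natDegree_mul_card_irreducible_le {d : ℕ} (hd : d ≠ 0) (S : Finset F[X])
    (hS : ∀ h ∈ S, h.Monic ∧ Irreducible h ∧ h.natDegree = d) :
    d * S.card ≤ Fintype.card F ^ d := by
  have hdvd : ∏ h ∈ S, h ∣ (X ^ Fintype.card F ^ d - X : F[X]) := by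
    refine Finset.prod_dvd_of_coprime ?_ fun h hh => ?_
    · intro a ha b hb hab
      have ha' := hS a ha
      have hb' := hS b hb
      refine (ha'.2.1.coprime_iff_not_dvd).2 fun hdv => hab ?_
      exact (eq_of_monic_of_dvd_of_natDegree_le ha'.1 hb'.1 hdv
        (by rw [ha'.2.2, hb'.2.2])).symm
    · rw [← Nat.card_eq_fintype_card]
      exact (hS h hh).2.1.natDegree_dvd_iff_dvd_X_pow_card_pow_sub_X.1 (hS h hh).2.2.dvd
  have hle := natDegree_le_of_dvd hdvd
    (FiniteField.X_pow_card_pow_sub_X_ne_zero _ hd Fintype.one_lt_card)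
  rw [FiniteField.X_pow_card_pow_sub_X_natDegree_eq _ hd Fintype.one_lt_card,
    natDegree_prod_of_monic _ _ fun h hh => (hS h hh).1,
    Finset.sum_congr rfl fun h hh => (hS h hh).2.2, Finset.sum_const, smul_eq_mul, mul_comm] at hle
  exact hle

lemma mul_card_starIrreducible_le {d : ℕ} (hd : 0 < d) (S : Finset F[X])
    (hS : ∀ g ∈ S, IsStarIrreducible g ∧ g.natDegree = 2 * d) :
    d * S.card ≤ Fintype.card F ^ d := by
  classical
  choose! φ hφm hφi hφd hφ using fun g (hg : g ∈ S) =>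
    (hS g hg).1.exists_irreducible hd (hS g hg).2
  have hinj : Set.InjOn φ S := fun a ha b hb hab => by
    rw [← hφ a ha, ← hφ b hb, hab]
  rw [← Finset.card_image_of_injOn hinj]
  refine natDegree_mul_card_irreducible_le hd.ne' _ fun h hh => ?_
  obtain ⟨g, hg, rfl⟩ := Finset.mem_image.1 hh
  exact ⟨hφm g hg, hφi g hg, hφd g hg⟩

/-- The weighted count of *-irreducible polynomials of a fixed degree. -/
lemma mul_card_starIrreducible_le_rpow (k : ℕ) (S : Finset F[X])
    (hS : ∀ g ∈ S, IsStarIrreducible g ∧ g.natDegree = k) :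
    (k * S.card : ℝ) ≤ 2 * (Fintype.card F : ℝ) ^ ((k : ℝ) / 2) := by
  have hq : (1 : ℝ) ≤ Fintype.card F := by exact_mod_cast Fintype.card_pos
  rcases Nat.even_or_odd k with ⟨d, hd⟩ | ho
  · have hkd : (k : ℝ) = 2 * d := by rw [hd]; push_cast; ring
    rcases Nat.eq_zero_or_pos d with rfl | hpos
    · rw [hkd]
      simp
    · have h := mul_card_starIrreducible_le hpos S fun g hg => by
        rw [two_mul, ← hd]; exact hS g hg
      have h' : (d * S.card : ℝ) ≤ (Fintype.card F : ℝ) ^ d := by exact_mod_cast h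
      rw [hkd, mul_div_cancel_left₀ _ two_ne_zero, Real.rpow_natCast]
      linarith
  · obtain ⟨h2, h1⟩ := card_starIrreducible_of_odd_le ho S hS
    have hone : (1 : ℝ) ≤ (Fintype.card F : ℝ) ^ ((k : ℝ) / 2) :=
      Real.one_le_rpow hq (by positivity)
    by_cases hk : k = 1
    · subst hk
      have : (S.card : ℝ) ≤ 2 := by exact_mod_cast h2
      push_cast at *
      linarith
    · rw [h1 hk]
      simp
      positivity

end Counting

section Combinatorics

open Finset

variable {α : Type*}

lemma sum_powersetCard_prod_le [DecidableEq α] (s : Finset α) {w : α → ℝ} (hw : ∀ a, 0 ≤ w a)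
    (k : ℕ) : ∑ T ∈ s.powersetCard k, ∏ a ∈ T, w a ≤ (∑ a ∈ s, w a) ^ k / (k.factorial : ℝ) := by
  induction s using Finset.induction_on generalizing k with
  | empty =>
    rcases Nat.eq_zero_or_pos k with rfl | hk
    · simp
    · rw [powersetCard_eq_empty.2 (by simpa using hk)]
      simp [hk.ne']
  | insert b s hb ih =>
    cases k with
    | zero => simp
    | succ k =>
      have hdisj : Disjoint (powersetCard (k + 1) s) ((powersetCard k s).image (insert b)) := by
        rw [Finset.disjoint_left]
        intro T hT hT'
        obtain ⟨U, -, rfl⟩ := mem_image.1 hT'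
        exact hb ((mem_powersetCard.1 hT).1 (mem_insert_self b U))
      have hinj : Set.InjOn (insert b) (powersetCard k s : Set (Finset α)) := by
        intro T hT U hU h
        have hbT : b ∉ T := fun h => hb ((mem_powersetCard.1 hT).1 h)
        have hbU : b ∉ U := fun h => hb ((mem_powersetCard.1 hU).1 h)
        rw [← erase_insert hbT, ← erase_insert hbU, h]
      have hprod : ∀ T ∈ powersetCard k s, ∏ a ∈ insert b T, w a = w b * ∏ a ∈ T, w a :=
        fun T hT => prod_insert fun h => hb ((mem_powersetCard.1 hT).1 h)
      rw [powersetCard_succ_insert hb, sum_union hdisj, sum_image hinj, sum_congr rfl hprod,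
        ← mul_sum, sum_insert hb]
      set H := ∑ a ∈ s, w a with hH
      have hH0 : 0 ≤ H := sum_nonneg fun a _ => hw a
      have hbern := pow_add_mul_le_add_pow_of_sq_nonneg hH0 (sq_nonneg (w b)) (sq_nonneg _)
        (by have := hw b; positivity) (k + 1)
      rw [Nat.add_sub_cancel] at hbern
      have hfac : ((k + 1).factorial : ℝ) = (k + 1) * k.factorial := by
        rw [Nat.factorial_succ]; push_cast; ring
      have hk0 : (0 : ℝ) < k.factorial := by exact_mod_cast k.factorial_pos
      calc _ ≤ H ^ (k + 1) / ((k + 1).factorial : ℝ) + w b * (H ^ k / (k.factorial : ℝ)) :=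
            add_le_add (ih (k + 1)) (mul_le_mul_of_nonneg_left (ih k) (hw b))
        _ = (H ^ (k + 1) + ((k + 1 : ℕ) : ℝ) * H ^ k * w b) / ((k + 1).factorial : ℝ) := by
            rw [hfac]
            field_simp
            push_cast
            ring
        _ ≤ _ := by
            rw [add_comm (w b) H]
            gcongr

/-- The subsets of `⋃ i, J i` meeting each `J i` in exactly `m i` elements. -/
def profileSets [DecidableEq α] {r : ℕ} (J : Fin r → Finset α) (m : Fin r → ℕ) :
    Finset (Finset α) :=
  {S ∈ (univ.biUnion J).powerset | ∀ i, #(S ∩ J i) = m i}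

variable [DecidableEq α] {r : ℕ} {J : Fin r → Finset α} {m : Fin r → ℕ}

lemma mem_profileSets {S : Finset α} :
    S ∈ profileSets J m ↔ S ⊆ univ.biUnion J ∧ ∀ i, #(S ∩ J i) = m i := by
  simp [profileSets]

lemma biUnion_inter_eq_of_subset {S : Finset α} (hS : S ⊆ univ.biUnion J) :
    univ.biUnion (fun i => S ∩ J i) = S := by
  rw [← inter_biUnion]
  exact inter_eq_left.2 hS

lemma pairwiseDisjoint_inter (hJ : ∀ i j, i ≠ j → Disjoint (J i) (J j)) (S : Finset α) :
    ((univ : Finset (Fin r)) : Set (Fin r)).PairwiseDisjoint (fun i => S ∩ J i) :=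
  fun i _ j _ hij => (hJ i j hij).mono inter_subset_right inter_subset_right

lemma sum_profileSets_prod_le (hJ : ∀ i j, i ≠ j → Disjoint (J i) (J j)) {w : α → ℝ}
    (hw : ∀ a, 0 ≤ w a) :
    ∑ S ∈ profileSets J m, ∏ a ∈ S, w a ≤
      ∏ i, (∑ a ∈ J i, w a) ^ m i / ((m i).factorial : ℝ) := by
  calc ∑ S ∈ profileSets J m, ∏ a ∈ S, w a
      = ∑ S ∈ profileSets J m, ∏ i, ∏ a ∈ S ∩ J i, w a := by
        refine sum_congr rfl fun S hS => ?_
        rw [← prod_biUnion (pairwiseDisjoint_inter hJ S),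
          biUnion_inter_eq_of_subset (mem_profileSets.1 hS).1]
    _ = ∑ T ∈ (profileSets J m).image (fun S i => S ∩ J i), ∏ i, ∏ a ∈ T i, w a := by
        rw [sum_image]
        intro S hS T hT h
        rw [← biUnion_inter_eq_of_subset (mem_profileSets.1 hS).1,
          ← biUnion_inter_eq_of_subset (mem_profileSets.1 hT).1]
        exact congrArg (fun f => univ.biUnion f) h
    _ ≤ ∑ T ∈ Fintype.piFinset fun i => (J i).powersetCard (m i), ∏ i, ∏ a ∈ T i, w a := by
        refine sum_le_sum_of_subset_of_nonneg ?_ fun T _ _ =>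
          prod_nonneg fun i _ => prod_nonneg fun a _ => hw a
        intro T hT
        obtain ⟨S, hS, rfl⟩ := mem_image.1 hT
        exact Fintype.mem_piFinset.2 fun i =>
          mem_powersetCard.2 ⟨inter_subset_right, (mem_profileSets.1 hS).2 i⟩
    _ = ∏ i, ∑ T ∈ (J i).powersetCard (m i), ∏ a ∈ T, w a :=
        (prod_univ_sum (fun i => (J i).powersetCard (m i)) fun _ T => ∏ a ∈ T, w a).symm
    _ ≤ _ := prod_le_prod
        (fun i _ => sum_nonneg fun T _ => prod_nonneg fun a _ => hw a)
        fun i _ => sum_powersetCard_prod_le (J i) hw (m i)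

lemma erase_mem_profileSets (hJ : ∀ i j, i ≠ j → Disjoint (J i) (J j)) {S : Finset α}
    (hS : S ∈ profileSets J m) {i : Fin r} {a : α} (ha : a ∈ S ∩ J i) :
    S.erase a ∈ profileSets J (Function.update m i (m i - 1)) := by
  rw [mem_profileSets] at hS ⊢
  refine ⟨(erase_subset a S).trans hS.1, fun j => ?_⟩
  rw [erase_inter]
  rcases eq_or_ne j i with rfl | hj
  · rw [card_erase_of_mem ha, hS.2, Function.update_self]
  · have : a ∉ S ∩ J j := fun h =>
      (Finset.disjoint_left.1 (hJ j i hj)) (mem_inter.1 h).2 (mem_inter.1 ha).2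
    rw [erase_eq_of_notMem this, hS.2, Function.update_of_ne hj]

/-- Removing one marked element from the `i`-th part. -/
lemma sum_marked_le (hJ : ∀ i j, i ≠ j → Disjoint (J i) (J j)) {deg : α → ℕ} {q : ℝ} (hq : 0 < q)
    (hcount : ∀ k : ℕ, ∑ a ∈ univ.biUnion J with deg a = k, (deg a : ℝ) ≤ 2 * q ^ ((k : ℝ) / 2))
    (N : ℕ) (i : Fin r) :
    ∑ S ∈ profileSets J m with ∑ a ∈ S, deg a = N, ∑ a ∈ S ∩ J i, (deg a : ℝ) ≤
      2 * q ^ ((N : ℝ) / 2) * ∑ A ∈ profileSets J (Function.update m i (m i - 1)),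
        ∏ a ∈ A, (q ^ ((deg a : ℝ) / 2))⁻¹ := by
  set U := univ.biUnion J with hU
  set m' := Function.update m i (m i - 1) with hm'
  have hstep : ∑ S ∈ profileSets J m with ∑ a ∈ S, deg a = N, ∑ a ∈ S ∩ J i, (deg a : ℝ) ≤
      ∑ A ∈ profileSets J m', ∑ a ∈ U with deg a + ∑ b ∈ A, deg b = N, (deg a : ℝ) := by
    rw [sum_sigma', sum_sigma']
    calc _ = ∑ x ∈ ((({S ∈ profileSets J m | ∑ a ∈ S, deg a = N}).sigma fun S => S ∩ J i).image
            fun x => (⟨x.1.erase x.2, x.2⟩ : (_ : Finset α) × α)), (deg x.2 : ℝ) := by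
          rw [sum_image]
          rintro ⟨S, a⟩ hx ⟨T, b⟩ hy h
          simp only [Sigma.mk.injEq, heq_eq_eq] at h
          obtain ⟨h1, rfl⟩ := h
          have hx2 : a ∈ S ∩ J i := (mem_sigma.1 hx).2
          have hy2 : a ∈ T ∩ J i := (mem_sigma.1 hy).2
          have : S = T := by
            rw [← insert_erase (mem_inter.1 hx2).1, h1, insert_erase (mem_inter.1 hy2).1]
          rw [this]
      _ ≤ _ := by
          refine sum_le_sum_of_subset_of_nonneg ?_ fun _ _ _ => Nat.cast_nonneg _
          intro x hx
          obtain ⟨⟨S, a⟩, hSa, rfl⟩ := mem_image.1 hx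
          obtain ⟨hS, ha⟩ := mem_sigma.1 hSa
          obtain ⟨hSm, hSN⟩ := mem_filter.1 hS
          have haS := (mem_inter.1 ha).1
          refine mem_sigma.2 ⟨erase_mem_profileSets hJ hSm ha, mem_filter.2 ⟨?_, ?_⟩⟩
          · exact (mem_profileSets.1 hSm).1 haS
          · exact (add_sum_erase S deg haS).trans hSN
  refine hstep.trans ?_
  rw [mul_sum]
  refine sum_le_sum fun A _ => ?_
  set D := ∑ b ∈ A, deg b with hD
  have hprod : ∏ a ∈ A, (q ^ ((deg a : ℝ) / 2))⁻¹ = (q ^ ((D : ℝ) / 2))⁻¹ := by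
    rw [prod_inv_distrib, ← Real.rpow_sum_of_pos hq, ← sum_div, hD]
    push_cast
    rfl
  rw [hprod]
  rcases le_or_gt D N with hDN | hDN
  · have hfil : ({a ∈ U | deg a + D = N} : Finset α) = {a ∈ U | deg a = N - D} := by
      refine filter_congr fun a _ => ?_
      omega
    rw [hfil]
    refine (hcount (N - D)).trans_eq ?_
    rw [mul_assoc, ← Real.rpow_neg hq.le, ← Real.rpow_add hq, Nat.cast_sub hDN]
    congr 2
    ring
  · rw [filter_false_of_mem fun a _ => by omega, sum_empty]
    positivity

lemma prod_update_pow_div_factorial {H : Fin r → ℝ} {i : Fin r} (hi : 0 < m i) (hH : 0 < H i) :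
    ∏ j, H j ^ (Function.update m i (m i - 1) j) /
        ((Function.update m i (m i - 1) j).factorial : ℝ) =
      (∏ j, H j ^ m j / ((m j).factorial : ℝ)) * (m i / H i) := by
  rw [← mul_prod_erase univ _ (mem_univ i),
    ← mul_prod_erase univ (fun j => H j ^ m j / ((m j).factorial : ℝ)) (mem_univ i),
    Function.update_self]
  have hrest : ∀ j ∈ univ.erase i, H j ^ (Function.update m i (m i - 1) j) /
      ((Function.update m i (m i - 1) j).factorial : ℝ) = H j ^ m j / ((m j).factorial : ℝ) :=
    fun j hj => by rw [Function.update_of_ne (ne_of_mem_erase hj)]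
  rw [prod_congr rfl hrest]
  obtain ⟨k, hk⟩ := Nat.exists_eq_succ_of_ne_zero hi.ne'
  rw [hk, Nat.succ_eq_add_one, Nat.add_sub_cancel, Nat.factorial_succ]
  have := (Nat.cast_pos (α := ℝ)).2 k.factorial_pos
  push_cast
  field_simp
  ring

/-- The number of sets of total degree `N` with prescribed profile. -/
lemma mul_card_profileSets_le (hJ : ∀ i j, i ≠ j → Disjoint (J i) (J j)) {deg : α → ℕ} {q : ℝ}
    (hq : 0 < q)
    (hcount : ∀ k : ℕ, ∑ a ∈ univ.biUnion J with deg a = k, (deg a : ℝ) ≤ 2 * q ^ ((k : ℝ) / 2))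
    (hm : ∀ i, J i = ∅ → m i = 0) (N : ℕ) {H : Fin r → ℝ}
    (hH : ∀ i, H i = ∑ a ∈ J i, (q ^ ((deg a : ℝ) / 2))⁻¹) :
    (N : ℝ) * #{S ∈ profileSets J m | ∑ a ∈ S, deg a = N} ≤
      2 * q ^ ((N : ℝ) / 2) * ((∏ i, H i ^ m i / ((m i).factorial : ℝ)) * ∑ i, m i / H i) := by
  have hwpos : ∀ a, 0 < (q ^ ((deg a : ℝ) / 2))⁻¹ := fun a => by positivity
  calc (N : ℝ) * #{S ∈ profileSets J m | ∑ a ∈ S, deg a = N}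
      = ∑ S ∈ profileSets J m with ∑ a ∈ S, deg a = N, ∑ i, ∑ a ∈ S ∩ J i, (deg a : ℝ) := by
        rw [mul_comm, ← nsmul_eq_mul, ← sum_const]
        refine sum_congr rfl fun S hS => ?_
        obtain ⟨hSm, hSN⟩ := mem_filter.1 hS
        rw [← sum_biUnion (pairwiseDisjoint_inter hJ S),
          biUnion_inter_eq_of_subset (mem_profileSets.1 hSm).1, ← hSN]
        push_cast
        rfl
    _ = ∑ i, ∑ S ∈ profileSets J m with ∑ a ∈ S, deg a = N, ∑ a ∈ S ∩ J i, (deg a : ℝ) :=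
        sum_comm
    _ ≤ ∑ i, 2 * q ^ ((N : ℝ) / 2) *
          ((∏ j, H j ^ m j / ((m j).factorial : ℝ)) * (m i / H i)) := by
        refine sum_le_sum fun i _ => ?_
        rcases Nat.eq_zero_or_pos (m i) with h0 | hpos
        · rw [h0, Nat.cast_zero, zero_div, mul_zero, mul_zero]
          refine (sum_eq_zero fun S hS => ?_).le
          have := (mem_profileSets.1 (mem_filter.1 hS).1).2 i
          rw [h0, card_eq_zero] at this
          rw [this, sum_empty]
        · have hHi : 0 < H i := by
            rw [hH]
            refine sum_pos (fun a _ => hwpos a) (nonempty_iff_ne_empty.2 fun h => ?_)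
            exact hpos.ne' (hm i h)
          refine (sum_marked_le hJ hq hcount N i).trans ?_
          refine mul_le_mul_of_nonneg_left ?_ (by positivity)
          rw [← prod_update_pow_div_factorial hpos hHi]
          simp only [hH]
          exact sum_profileSets_prod_le hJ fun a => (hwpos a).le
    _ = _ := by rw [← mul_sum, ← mul_sum]

end Combinatorics

section Assembly

open Finset

/-- Squarefree *-symmetric polynomials are determined by their sets of *-irreducible divisors. -/
lemma ncard_starSymm_le {F : Type} [Field F] [DecidableEq F[X]] {n r : ℕ} {I : Fin r → Set F[X]}
    {J : Fin r → Finset F[X]} (hIJ : ∀ i, I i = J i)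
    (hU : ∀ g, g ∈ univ.biUnion J ↔ IsStarIrreducible g ∧ g.natDegree ≤ 2 * n) (m : Fin r → ℕ) :
    {f : F[X] | f.Monic ∧ Squarefree f ∧ IsStarSymm f ∧ f.natDegree = 2 * n ∧
      f.coeff 0 = 1 ∧ ∀ i, {g ∈ I i | g ∣ f}.ncard = m i}.ncard ≤
      #{S ∈ profileSets J m | ∑ g ∈ S, g.natDegree = 2 * n} := by
  classical
  have hdiv : ∀ f : F[X], f.Monic → f.natDegree = 2 * n → ∀ g,
      g ∈ ({g ∈ univ.biUnion J | g ∣ f} : Finset F[X]) ↔ IsStarIrreducible g ∧ g ∣ f := by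
    intro f hf hfd g
    rw [mem_filter, hU]
    exact ⟨fun h => ⟨h.1.1, h.2⟩,
      fun h => ⟨⟨h.1, (natDegree_le_of_dvd h.2 hf.ne_zero).trans hfd.le⟩, h.2⟩⟩
  rw [← Set.ncard_coe_finset]
  refine Set.ncard_le_ncard_of_injOn (fun f => ({g ∈ univ.biUnion J | g ∣ f} : Finset F[X]))
    ?_ ?_ (Finset.finite_toSet _)
  · rintro f ⟨hm, hs, hf, hfd, -, hcard⟩
    rw [mem_coe, mem_filter, mem_profileSets]
    refine ⟨⟨filter_subset _ _, fun i => ?_⟩, ?_⟩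
    · rw [← hcard i, ← Set.ncard_coe_finset]
      congr 1
      ext g
      simp only [coe_inter, coe_filter, Set.mem_inter_iff, Set.mem_ofPred_eq, mem_coe, hIJ]
      refine ⟨fun h => ⟨h.2, h.1.2⟩, fun h => ⟨⟨mem_biUnion.2 ⟨i, mem_univ i, h.1⟩, h.2⟩, h.1⟩⟩
    · have hprod := IsStarIrreducible.prod_eq_of_squarefree hm hs hf _ (hdiv f hm hfd)
      rw [← hfd]
      conv_rhs => rw [← hprod]
      rw [natDegree_prod_of_monic]
      exact fun g hg => ((hdiv f hm hfd g).1 hg).1.1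
  · rintro f ⟨hm, hs, hf, hfd, -⟩ f' ⟨hm', hs', hf', hfd', -⟩ h
    rw [← IsStarIrreducible.prod_eq_of_squarefree hm hs hf _ (hdiv f hm hfd),
      ← IsStarIrreducible.prod_eq_of_squarefree hm' hs' hf' _ (hdiv f' hm' hfd')]
    exact congrArg (fun S : Finset F[X] => ∏ g ∈ S, g) h

variable {F : Type} [Field F] [Fintype F]

lemma finite_setOf_natDegree_le (N : ℕ) : {g : F[X] | g.natDegree ≤ N}.Finite := by
  refine Set.Finite.of_finite_image (f := fun g (i : Fin (N + 1)) => g.coeff i)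
    (Set.toFinite _) fun a ha b hb hab => ?_
  ext i
  rcases Nat.lt_or_ge i (N + 1) with hi | hi
  · exact congrFun hab ⟨i, hi⟩
  · rw [coeff_eq_zero_of_natDegree_lt (lt_of_le_of_lt ha hi),
      coeff_eq_zero_of_natDegree_lt (lt_of_le_of_lt hb hi)]

lemma sum_starIrreducible_le {n : ℕ} (U : Finset F[X])
    (hU : ∀ g ∈ U, IsStarIrreducible g ∧ g.natDegree ≤ 2 * n) :
    ∑ g ∈ U, ((Fintype.card F : ℝ) ^ ((g.natDegree : ℝ) / 2))⁻¹ ≤ 3 + Real.log n := by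
  classical
  have hq : (1 : ℝ) ≤ Fintype.card F := by exact_mod_cast Fintype.card_pos
  have hq0 : (0 : ℝ) < Fintype.card F := by linarith
  rw [← sum_filter_add_sum_filter_not U (fun g => Even g.natDegree)]
  have hodd : ∑ g ∈ U with ¬ Even g.natDegree,
      ((Fintype.card F : ℝ) ^ ((g.natDegree : ℝ) / 2))⁻¹ ≤ 2 := by
    have hcard : #{g ∈ U | ¬ Even g.natDegree} ≤ 2 := by
      refine (card_le_card (t := {X - C 1, X - C (-1)}) fun g hg => ?_).trans card_le_two
      obtain ⟨hgU, hgo⟩ := mem_filter.1 hg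
      have := (hU g hgU).1.classification
      rw [mem_insert, mem_singleton]
      tauto
    calc _ ≤ ∑ g ∈ U with ¬ Even g.natDegree, (1 : ℝ) :=
          sum_le_sum fun g _ => inv_le_one_of_one_le₀ (Real.one_le_rpow hq (by positivity))
      _ ≤ 2 := by
          rw [sum_const, nsmul_eq_mul, mul_one]
          exact_mod_cast hcard
  have heven : ∑ g ∈ U with Even g.natDegree,
      ((Fintype.card F : ℝ) ^ ((g.natDegree : ℝ) / 2))⁻¹ ≤ 1 + Real.log n := by
    have hmaps : ∀ g ∈ ({g ∈ U | Even g.natDegree} : Finset F[X]),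
        g.natDegree / 2 ∈ Icc 1 n := fun g hg => by
      obtain ⟨hgU, d, hd⟩ := mem_filter.1 hg
      have h1 := (hU g hgU).1.2.1
      have h2 := (hU g hgU).2
      rw [mem_Icc]
      omega
    rw [← sum_fiberwise_of_maps_to hmaps]
    refine le_trans (sum_le_sum (g := fun d : ℕ => (d : ℝ)⁻¹) fun d hd => ?_) ?_
    · have hd1 : 0 < d := (mem_Icc.1 hd).1
      have hdeg : ∀ g ∈ ({g ∈ ({g ∈ U | Even g.natDegree} : Finset F[X]) |
          g.natDegree / 2 = d} : Finset F[X]),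
          IsStarIrreducible g ∧ g.natDegree = 2 * d := fun g hg => by
        obtain ⟨hg1, hg2⟩ := mem_filter.1 hg
        obtain ⟨hgU, e, he⟩ := mem_filter.1 hg1
        exact ⟨(hU g hgU).1, by omega⟩
      have hw : ∀ g ∈ ({g ∈ ({g ∈ U | Even g.natDegree} : Finset F[X]) |
          g.natDegree / 2 = d} : Finset F[X]),
          ((Fintype.card F : ℝ) ^ ((g.natDegree : ℝ) / 2))⁻¹ = ((Fintype.card F : ℝ) ^ d)⁻¹ :=
        fun g hg => by
          rw [(hdeg g hg).2, Nat.cast_mul, Nat.cast_two, mul_div_cancel_left₀ _ two_ne_zero,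
            Real.rpow_natCast]
      rw [sum_congr rfl hw, sum_const, nsmul_eq_mul]
      have h := mul_card_starIrreducible_le hd1 _ hdeg
      have h' : (d : ℝ) * #{g ∈ ({g ∈ U | Even g.natDegree} : Finset F[X]) |
          g.natDegree / 2 = d} ≤ (Fintype.card F : ℝ) ^ d := by exact_mod_cast h
      have hd0 : (0 : ℝ) < d := by exact_mod_cast hd1
      rw [← div_eq_mul_inv, div_le_iff₀ (by positivity), inv_mul_eq_div, le_div_iff₀ hd0]
      linarith
    · have h := harmonic_le_one_add_log n
      rw [harmonic_eq_sum_Icc] at h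
      push_cast at h
      exact h
  linarith

lemma sum_natDegree_starIrreducible_le (U : Finset F[X]) (hU : ∀ g ∈ U, IsStarIrreducible g)
    (k : ℕ) :
    ∑ g ∈ U with g.natDegree = k, (g.natDegree : ℝ) ≤
      2 * (Fintype.card F : ℝ) ^ ((k : ℝ) / 2) := by
  have h := mul_card_starIrreducible_le_rpow k {g ∈ U | g.natDegree = k} fun g hg =>
    ⟨hU g (mem_filter.1 hg).1, (mem_filter.1 hg).2⟩
  refine le_trans (le_of_eq ?_) h
  rw [sum_congr rfl fun g hg => by rw [(mem_filter.1 hg).2], sum_const, nsmul_eq_mul, mul_comm]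

end Assembly

/-- **Poisson-type tail bound, *-symmetric case.**
For any partition `I_1, …, I_r` of the (monic) *-irreducible polynomials of degree `≤ 2n` over a
finite field with `q` elements, and any `m_1, …, m_r ≥ 0` (with `m_i = 0` when `I_i = ∅`), the
number of squarefree *-symmetric monic `f` of degree `2n` with constant coefficient `1` having
exactly `m_i` distinct *-irreducible factors in `I_i` for each `i` is
`≤ C qⁿ ∏_i (e^{-H*(I_i)} H*(I_i)^{m_i}/m_i!) ⬝ (∑_i m_i/H*(I_i))`. -/
theorem stmt4 : ∃ C : ℝ, 0 < C ∧
    ∀ (F : Type) [Field F] [Fintype F], ∀ (q n r : ℕ),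
      Fintype.card F = q → 1 ≤ n →
      ∀ I : Fin r → Set F[X],
        (∀ i j, i ≠ j → Disjoint (I i) (I j)) →
        (⋃ i, I i) = {g : F[X] | IsStarIrreducible g ∧ g.natDegree ≤ 2 * n} →
      ∀ m : Fin r → ℕ, (∀ i, I i = ∅ → m i = 0) →
        ({f : F[X] | f.Monic ∧ Squarefree f ∧ IsStarSymm f ∧ f.natDegree = 2 * n ∧
            f.coeff 0 = 1 ∧ ∀ i, {g ∈ I i | g ∣ f}.ncard = m i}.ncard : ℝ) ≤
          C * (q : ℝ) ^ n *
            (∏ i : Fin r, Real.exp (-(polyHstar q (I i))) * (polyHstar q (I i)) ^ (m i) /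
              (Nat.factorial (m i) : ℝ)) *
            (∑ i : Fin r, (m i : ℝ) / polyHstar q (I i)) := by
  classical
  refine ⟨Real.exp 3, Real.exp_pos 3, ?_⟩
  intro F _ _ q n r hq hn I hdisj hunion m hm
  subst hq
  have hfin : ∀ i, (I i).Finite := fun i =>
    (finite_setOf_natDegree_le (2 * n)).subset fun g hg =>
      (hunion.subset (Set.mem_iUnion.2 ⟨i, hg⟩)).2
  set J : Fin r → Finset F[X] := fun i => (hfin i).toFinset with hJdef
  have hIJ : ∀ i, I i = J i := fun i => ((hfin i).coe_toFinset).symm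
  have hU : ∀ g, g ∈ Finset.univ.biUnion J ↔ IsStarIrreducible g ∧ g.natDegree ≤ 2 * n := by
    intro g
    rw [show (IsStarIrreducible g ∧ g.natDegree ≤ 2 * n) ↔
      g ∈ {g : F[X] | IsStarIrreducible g ∧ g.natDegree ≤ 2 * n} from Iff.rfl, ← hunion]
    simp [hJdef]
  have hJ : ∀ i j, i ≠ j → Disjoint (J i) (J j) := fun i j hij => by
    rw [← Finset.disjoint_coe, ← hIJ, ← hIJ]
    exact hdisj i j hij
  have hmJ : ∀ i, J i = ∅ → m i = 0 := fun i h => hm i (by rw [hIJ, h, Finset.coe_empty])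
  have hH : ∀ i, polyHstar (Fintype.card F) (I i) =
      ∑ g ∈ J i, ((Fintype.card F : ℝ) ^ ((g.natDegree : ℝ) / 2))⁻¹ := fun i =>
    finsum_mem_eq_finite_toFinset_sum _ (hfin i)
  obtain ⟨H, hHI⟩ : ∃ H : Fin r → ℝ, ∀ i, polyHstar (Fintype.card F) (I i) = H i :=
    ⟨_, fun _ => rfl⟩
  simp only [hHI] at hH ⊢
  have hq0 : (0 : ℝ) < Fintype.card F := by exact_mod_cast Fintype.card_pos
  have hn0 : (0 : ℝ) < n := by exact_mod_cast hn
  have hH0 : ∀ i, 0 ≤ H i := fun i => by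
    rw [hH]
    exact Finset.sum_nonneg fun g _ => by positivity
  have hcount := mul_card_profileSets_le (m := m) hJ hq0
    (sum_natDegree_starIrreducible_le _ fun g hg => ((hU g).1 hg).1) hmJ (2 * n) hH
  have hncard := ncard_starSymm_le hIJ hU m
  have htotal : ∑ i, H i ≤ 3 + Real.log n := by
    have h := sum_starIrreducible_le (Finset.univ.biUnion J) fun g hg => (hU g).1 hg
    rw [Finset.sum_biUnion fun i _ j _ hij => hJ i j hij] at h
    exact (Finset.sum_congr rfl fun i _ => hH i).trans_le h
  have hexp : 1 ≤ n * (Real.exp 3 * Real.exp (-∑ i, H i)) := by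
    have h1 : Real.exp (∑ i, H i) ≤ Real.exp 3 * n := by
      have h := Real.exp_le_exp.2 htotal
      rwa [Real.exp_add, Real.exp_log hn0] at h
    rw [Real.exp_neg, ← mul_assoc, ← div_eq_mul_inv, le_div_iff₀ (Real.exp_pos _), one_mul]
    linarith
  have hprod : ∏ i, Real.exp (-(H i)) * H i ^ m i / ((m i).factorial : ℝ) =
      Real.exp (-∑ i, H i) * ∏ i, H i ^ m i / ((m i).factorial : ℝ) := by
    rw [← Finset.sum_neg_distrib, Real.exp_sum, ← Finset.prod_mul_distrib]
    exact Finset.prod_congr rfl fun i _ => mul_div_assoc _ _ _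
  have hP : 0 ≤ (∏ i, H i ^ m i / ((m i).factorial : ℝ)) * ∑ i, (m i : ℝ) / H i :=
    mul_nonneg (Finset.prod_nonneg fun i _ => by have := hH0 i; positivity)
      (Finset.sum_nonneg fun i _ => by have := hH0 i; positivity)
  rw [hprod]
  set P := (∏ i, H i ^ m i / ((m i).factorial : ℝ)) with hPdef
  set M := ∑ i, (m i : ℝ) / H i with hM
  rw [Nat.cast_mul, Nat.cast_two, mul_div_cancel_left₀ _ two_ne_zero, Real.rpow_natCast] at hcount
  refine (Nat.cast_le.2 hncard).trans ?_
  have hqP : 0 ≤ (Fintype.card F : ℝ) ^ n * (P * M) := by positivity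
  refine le_of_mul_le_mul_left ?_ hn0
  calc _ ≤ (Fintype.card F : ℝ) ^ n * (P * M) := by linarith
    _ ≤ (n * (Real.exp 3 * Real.exp (-∑ i, H i))) * ((Fintype.card F : ℝ) ^ n * (P * M)) :=
        le_mul_of_one_le_left hqP hexp
    _ = _ := by ring
end
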